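/- Let Q = ℝⁿ × (0,∞), let L be a nondivergence parabolic operator on Q with ellipticity constant ν, and let (ω^X) be the L-caloric measure for Q. Let Y = (y,0) ∈ ∂_pQ and r > 0. Then there exists N = N(n, ν) ≥ 1 such that ω^X(Δ_{2r}(Y)) ≥ 1/N for every X in Q_r(Y) = B_r(y) × (0, r²), where Δ_{2r}(Y) = B_{2r}(y) × {0}. -/

import Mathlib

open MeasureTheory Set Metric Filter

noncomputable section

/-- Euclidean space `ℝⁿ`. -/
abbrev E (n : ℕ) : Type := EuclideanSpace ℝ (Fin n)

/-- Second spatial partial derivative `D_i D_j u` at a space-time point `X`. -/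
def D2 {n : ℕ} (u : E n × ℝ → ℝ) (X : E n × ℝ) (i j : Fin n) : ℝ :=
  fderiv ℝ (fun x => fderiv ℝ (fun x' => u (x', X.2)) x (EuclideanSpace.single j 1))
    X.1 (EuclideanSpace.single i 1)

/-- Time derivative `D_t u` at a space-time point `X`. -/
def Dt {n : ℕ} (u : E n × ℝ → ℝ) (X : E n × ℝ) : ℝ :=
  deriv (fun t => u (X.1, t)) X.2

/-- The value `Lu(X)` of the nondivergence parabolic operator with coefficients `a`. -/
def LVal {n : ℕ} (a : E n × ℝ → Fin n → Fin n → ℝ) (u : E n × ℝ → ℝ) (X : E n × ℝ) : ℝ :=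
  (∑ i, ∑ j, a X i j * D2 u X i j) - Dt u X

/-- `u` is C² in `x` and C¹ in `t` at every point of `V`. -/
def ParabolicSmoothOn {n : ℕ} (u : E n × ℝ → ℝ) (V : Set (E n × ℝ)) : Prop :=
  ∀ X ∈ V, ContDiffAt ℝ 2 (fun x => u (x, X.2)) X.1 ∧
    DifferentiableAt ℝ (fun t => u (X.1, t)) X.2

/-- `u` solves `Lu = 0` pointwise in `V` (being C² in `x`, C¹ in `t` there). -/
def SolvesL {n : ℕ} (a : E n × ℝ → Fin n → Fin n → ℝ) (u : E n × ℝ → ℝ)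
    (V : Set (E n × ℝ)) : Prop :=
  ParabolicSmoothOn u V ∧ ∀ X ∈ V, LVal a u X = 0

/-- `a` is a smooth coefficient matrix on `S`, uniformly elliptic with constant `ν`
and with entries bounded by `ν⁻¹`. -/
def IsParabolicCoeff {n : ℕ} (ν : ℝ) (a : E n × ℝ → Fin n → Fin n → ℝ)
    (S : Set (E n × ℝ)) : Prop :=
  (∀ i j, ContDiffOn ℝ (⊤ : ℕ∞) (fun X => a X i j) S) ∧
  ∀ X ∈ S, (∀ ξ : Fin n → ℝ, ν * ∑ i, ξ i ^ 2 ≤ ∑ i, ∑ j, a X i j * ξ i * ξ j) ∧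
    ∀ i j, |a X i j| ≤ ν⁻¹

/-- The cylinder `Ω × (t₀, ∞)`. -/
def CylFrom {n : ℕ} (Ω : Set (E n)) (t₀ : ℝ) : Set (E n × ℝ) := Ω ×ˢ Ioi t₀

/-- The cylinder `Q = Ω × (0, ∞)`. -/
def Cyl {n : ℕ} (Ω : Set (E n)) : Set (E n × ℝ) := CylFrom Ω 0

/-- Parabolic boundary of the cylinder `Ω × (t₀, ∞)`:
`(∂Ω × (t₀,∞)) ∪ (cl(Ω) × {t₀})`. -/
def pBFrom {n : ℕ} (Ω : Set (E n)) (t₀ : ℝ) : Set (E n × ℝ) :=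
  (frontier Ω ×ˢ Ioi t₀) ∪ (closure Ω ×ˢ {t₀})

/-- Parabolic boundary of `Ω × (0, ∞)`. -/
def pB {n : ℕ} (Ω : Set (E n)) : Set (E n × ℝ) := pBFrom Ω 0

/-- The cylinder `C_{R,r}(Y) = B_R(y) × (s - r², s + r²)`. -/
def CRr {n : ℕ} (Y : E n × ℝ) (R r : ℝ) : Set (E n × ℝ) :=
  ball Y.1 R ×ˢ Ioo (Y.2 - r ^ 2) (Y.2 + r ^ 2)

/-- The standard cylinder `C_r(Y) = B_r(y) × (s - r², s + r²)`. -/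
def Cr {n : ℕ} (Y : E n × ℝ) (r : ℝ) : Set (E n × ℝ) := CRr Y r r

/-- `ω` is the `L`-caloric measure family for the cylinder `Ω × (t₀, ∞)`:
each `ω X` is a Borel probability measure on the parabolic boundary, and for every
bounded continuous `φ`, `X ↦ ∫ φ dω^X` is a (bounded) solution of `Lu = 0` in the
cylinder extending continuously to `φ` at each point of the parabolic boundary. -/
def IsCaloricMeasureFrom {n : ℕ} (a : E n × ℝ → Fin n → Fin n → ℝ) (Ω : Set (E n))
    (t₀ : ℝ) (ω : E n × ℝ → Measure (E n × ℝ)) : Prop :=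
  (∀ X ∈ CylFrom Ω t₀, IsProbabilityMeasure (ω X) ∧ ω X (pBFrom Ω t₀)ᶜ = 0) ∧
  ∀ φ : E n × ℝ → ℝ, Continuous φ → (∃ M, ∀ z, |φ z| ≤ M) →
    SolvesL a (fun X => ∫ z, φ z ∂ω X) (CylFrom Ω t₀) ∧
    ∀ Z ∈ pBFrom Ω t₀, Tendsto (fun X => ∫ z, φ z ∂ω X)
      (nhdsWithin Z (CylFrom Ω t₀)) (nhds (φ Z))

/-- `ω` is the `L`-caloric measure family for `Q = Ω × (0, ∞)`. -/
def IsCaloricMeasure {n : ℕ} (a : E n × ℝ → Fin n → Fin n → ℝ) (Ω : Set (E n))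
    (ω : E n × ℝ → Measure (E n × ℝ)) : Prop :=
  IsCaloricMeasureFrom a Ω 0 ω

/-- `Ω` is a Lipschitz domain with constants `m, r₀ > 0`: it is a nonempty open
connected set and near each boundary point, in a suitable orthonormal coordinate
system centered at that point, it coincides with the region above the graph of a
function with `‖∇φ‖_{L^∞} ≤ m` (equivalently, `m`-Lipschitz). -/
def IsLipschitzDomain {n : ℕ} (hn : 0 < n) (Ω : Set (E n)) (m r₀ : ℝ) : Prop :=
  IsOpen Ω ∧ Ω.Nonempty ∧ IsConnected Ω ∧ 0 < m ∧ 0 < r₀ ∧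
  ∀ y ∈ frontier Ω, ∃ (T : E n ≃ₗᵢ[ℝ] E n) (φ : E (n - 1) → ℝ),
    LipschitzWith m.toNNReal φ ∧
    ∀ x : E n, x ∈ Ω ∩ ball y r₀ ↔
      ‖x - y‖ < r₀ ∧
        φ ((EuclideanSpace.equiv (Fin (n - 1)) ℝ).symm
            (fun i => T (x - y) (Fin.castLE (Nat.sub_le n 1) i))) <
          T (x - y) ⟨n - 1, Nat.sub_lt hn Nat.one_pos⟩

/-- The set `Ω^δ = {x ∈ Ω : dist(x, ∂Ω) > δ}`. -/
def innerSet {n : ℕ} (Ω : Set (E n)) (δ : ℝ) : Set (E n) :=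
  {x ∈ Ω | δ < infDist x (frontier Ω)}

/-- The corkscrew property (2.3) with constant `μ`. -/
def Corkscrew {n : ℕ} (Ω : Set (E n)) (r₀ μ : ℝ) : Prop :=
  ∀ y ∈ frontier Ω, ∀ r : ℝ, 0 < r → r < r₀ →
    (∃ y₁ : E n, ball y₁ (2 * μ * r) ⊆ ball y r ∩ Ω) ∧
    (∃ y₂ : E n, ball y₂ (2 * μ * r) ⊆ ball y r \ Ω)

open scoped Topology

/-- Right lower semicontinuity of `g` at `(x,t)`. -/
def RL {α : Type*} [TopologicalSpace α] (g : α → ℝ → ℝ) (x : α) (t : ℝ) : Prop :=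
  ∀ ε > 0, ∀ᶠ p in 𝓝 x ×ˢ 𝓝[>] t, g x t - ε < g p.1 p.2

/-- Abstract minimum principle. -/
lemma abstract_min {α : Type*} [TopologicalSpace α] (K : Set α) (hK : IsCompact K)
    (g : α → ℝ → ℝ) (t0 t1 : ℝ)
    (hcont : ∀ t ∈ Ioc t0 t1, ContinuousOn (fun x => g x t) K)
    (hR : ∀ t ∈ Ico t0 t1, ∀ x ∈ K, RL g x t)
    (hstart : ∀ x ∈ K, 0 ≤ g x t0)
    (hP : ∀ t ∈ Ioc t0 t1, ∀ x ∈ K, (∀ y ∈ K, g x t ≤ g y t) → g x t < 0 →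
      ∃ s ∈ Ico t0 t, g x s ≤ g x t) :
    ∀ t ∈ Icc t0 t1, ∀ x ∈ K, 0 ≤ g x t := by
  intro t' ht' x1 hx1
  by_contra hneg
  push Not at hneg
  set c := g x1 t' with hc
  set A : Set ℝ := {s | s ∈ Icc t0 t' ∧ ∃ x ∈ K, g x s ≤ c} with hA
  have hAne : t' ∈ A := ⟨⟨ht'.1, le_rfl⟩, x1, hx1, le_rfl⟩
  have hAbdd : BddBelow A := ⟨t0, fun s hs => hs.1.1⟩
  set s' := sInf A with hs'
  have hs0 : t0 ≤ s' := le_csInf ⟨_, hAne⟩ (fun s hs => hs.1.1)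
  have hs1 : s' ≤ t' := csInf_le hAbdd hAne
  have hmem : s' ∈ A := by
    by_contra hnot
    have hlt : s' < t' := lt_of_le_of_ne hs1 (fun h => hnot (h ▸ hAne))
    have hgt : ∀ x ∈ K, c < g x s' := by
      intro x hx
      by_contra h
      exact hnot ⟨⟨hs0, hs1⟩, x, hx, not_lt.1 h⟩
    have h1 : {p : α × ℝ | c < g p.1 p.2} ∈ 𝓝ˢ K ×ˢ 𝓝[>] s' := by
      apply hK.mem_nhdsSet_prod_of_forall
      intro x hx
      have := hR s' ⟨hs0, hlt.trans_le ht'.2⟩ x hx (g x s' - c) (by linarith [hgt x hx])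
      filter_upwards [this] with p hp
      simpa using hp
    rw [Filter.mem_prod_iff] at h1
    obtain ⟨U, hU, V, hV, hUV⟩ := h1
    have hKU : K ⊆ U := subset_of_mem_nhdsSet hU
    obtain ⟨b, hb, hbV⟩ := (mem_nhdsGT_iff_exists_Ioo_subset' hlt).1 hV
    obtain ⟨s, hsA, hsb⟩ := exists_lt_of_csInf_lt ⟨_, hAne⟩ (show sInf A < b from hb)
    have hs's : s' < s := lt_of_le_of_ne (csInf_le hAbdd hsA) (fun h => hnot (h ▸ hsA))
    obtain ⟨_, x, hx, hxs⟩ := hsA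
    have : (x, s) ∈ {p : α × ℝ | c < g p.1 p.2} := hUV ⟨hKU hx, hbV ⟨hs's, hsb⟩⟩
    simp only [mem_ofPred_eq] at this
    linarith
  obtain ⟨_, x, hx, hxs⟩ := hmem
  rcases hs0.eq_or_lt with h | h
  · have := hstart x hx
    rw [h] at this
    linarith
  · have hIoc : s' ∈ Ioc t0 t1 := ⟨h, hs1.trans ht'.2⟩
    obtain ⟨z, hz, hzmin⟩ := hK.exists_isMinOn ⟨x, hx⟩ (hcont s' hIoc)
    have hzle : g z s' ≤ c := le_trans (hzmin hx) hxs
    obtain ⟨s, hs, hsg⟩ := hP s' hIoc z hz (fun y hy => hzmin hy) (by linarith)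
    have : s ∈ A := ⟨⟨hs.1, (hs.2.le).trans hs1⟩, z, hz, hsg.trans hzle⟩
    have := csInf_le hAbdd this
    have := hs.2
    linarith

/-- Second derivative test (necessary condition). -/
lemma second_deriv_nonneg (h h1 : ℝ → ℝ) (h2 : ℝ)
    (hd : ∀ᶠ τ in 𝓝 (0:ℝ), HasDerivAt h (h1 τ) τ) (hd2 : HasDerivAt h1 h2 0)
    (hmin : IsLocalMin h 0) : 0 ≤ h2 := by
  by_contra hneg
  push Not at hneg
  have e1 : deriv h =ᶠ[𝓝 0] h1 := hd.mono (fun τ hτ => hτ.deriv)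
  have e2 : deriv (deriv h) 0 = h2 := by rw [e1.deriv_eq, hd2.deriv]
  have hmax : IsLocalMax h 0 := isLocalMax_of_deriv_deriv_neg (by rw [e2]; exact hneg)
    hmin.deriv_eq_zero hd.self_of_nhds.continuousAt
  have hconst : h =ᶠ[𝓝 0] fun _ => h 0 := by
    filter_upwards [hmin, hmax] with τ a b using le_antisymm b a
  have : deriv h =ᶠ[𝓝 0] fun _ => 0 := by
    have := hconst.deriv
    simpa using this
  have e3 : deriv (deriv h) 0 = 0 := by rw [this.deriv_eq]; simp
  rw [e2] at e3
  linarith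

open scoped MatrixOrder Matrix.Norms.L2Operator in
/-- Trace of a product: `A` accretive and `M` symmetric nonnegative. -/
lemma trace_nonneg {n : ℕ} (A M : Fin n → Fin n → ℝ)
    (hA : ∀ ξ : Fin n → ℝ, 0 ≤ ∑ i, ∑ j, A i j * ξ i * ξ j)
    (hs : ∀ i j, M i j = M j i)
    (hM : ∀ ξ : Fin n → ℝ, 0 ≤ ∑ i, ∑ j, M i j * ξ i * ξ j) :
    0 ≤ ∑ i, ∑ j, A i j * M i j := by
  have hp : (Matrix.of M).PosSemidef := by
    apply Matrix.PosSemidef.of_dotProduct_mulVec_nonneg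
    · ext i j
      simp [hs i j]
    · intro x
      have := hM x
      simp only [dotProduct, Matrix.mulVec, Matrix.of_apply, Pi.star_apply, star_trivial,
        Finset.mul_sum]
      refine this.trans_eq (Finset.sum_congr rfl fun i _ => Finset.sum_congr rfl fun j _ => ?_)
      ring
  obtain ⟨B, hB⟩ := CStarAlgebra.nonneg_iff_eq_star_mul_self.1 hp.nonneg
  have hMB : ∀ i j, M i j = ∑ k, B k i * B k j := by
    intro i j
    have := congrFun (congrFun hB i) j
    simpa [Matrix.mul_apply, Matrix.star_apply] using this
  have : ∑ i, ∑ j, A i j * M i j = ∑ k, ∑ i, ∑ j, A i j * B k i * B k j := by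
    simp_rw [hMB, Finset.mul_sum]
    rw [Finset.sum_comm' (t' := Finset.univ) (s' := fun _ => Finset.univ) (by simp)]
    rw [Finset.sum_comm]
    rw [Finset.sum_comm (s := (Finset.univ : Finset (Fin n))) (t := (Finset.univ : Finset (Fin n)))
      (f := fun k i => ∑ j, A i j * B k i * B k j)]
    refine Finset.sum_congr rfl fun i _ => ?_
    rw [Finset.sum_comm]
    refine Finset.sum_congr rfl fun i _ => Finset.sum_congr rfl fun i _ => ?_
    ring
  rw [this]
  exact Finset.sum_nonneg fun k _ => hA (B k)

/-- Second spatial partial derivatives of a function on `ℝⁿ`. -/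
def Hs {n : ℕ} (f : E n → ℝ) (x : E n) (i j : Fin n) : ℝ :=
  fderiv ℝ (fun x => fderiv ℝ f x (EuclideanSpace.single j 1)) x (EuclideanSpace.single i 1)

lemma Hs_eq {n : ℕ} (f : E n → ℝ) (x : E n) (hf : ContDiffAt ℝ 2 f x) (i j : Fin n) :
    Hs f x i j = fderiv ℝ (fderiv ℝ f) x (EuclideanSpace.single i 1)
      (EuclideanSpace.single j 1) := by
  have hd : DifferentiableAt ℝ (fderiv ℝ f) x :=
    (hf.fderiv_right (m := 1) (by norm_num)).differentiableAt (by norm_num)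
  unfold Hs
  rw [fderiv_clm_apply hd (differentiableAt_const _)]
  simp

lemma Hs_symm {n : ℕ} (f : E n → ℝ) (x : E n) (hf : ContDiffAt ℝ 2 f x) (i j : Fin n) :
    Hs f x i j = Hs f x j i := by
  rw [Hs_eq f x hf, Hs_eq f x hf]
  exact (hf.isSymmSndFDerivAt (by simp)) _ _

lemma Hs_quad {n : ℕ} (f : E n → ℝ) (x : E n) (hf : ContDiffAt ℝ 2 f x) (v : E n) :
    fderiv ℝ (fderiv ℝ f) x v v = ∑ i, ∑ j, Hs f x i j * v i * v j := by
  have hv : v = ∑ i, v i • EuclideanSpace.single i (1:ℝ) := by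
    ext k
    simp [Finset.sum_apply, Pi.single_apply]
  conv_lhs => rw [hv]
  simp only [map_sum, map_smul, sum_apply, smul_apply,
    smul_eq_mul, Finset.mul_sum]
  refine Finset.sum_congr rfl fun i _ => Finset.sum_congr rfl fun j _ => ?_
  rw [Hs_symm f x hf, Hs_eq f x hf]
  ring

lemma line_deriv {n : ℕ} (f : E n → ℝ) (x : E n) (hf : ContDiffAt ℝ 2 f x) (v : E n) :
    ∃ h1 : ℝ → ℝ, (∀ᶠ τ in 𝓝 (0:ℝ), HasDerivAt (fun τ : ℝ => f (x + τ • v)) (h1 τ) τ) ∧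
      HasDerivAt h1 (∑ i, ∑ j, Hs f x i j * v i * v j) 0 := by
  have hl : ∀ τ : ℝ, HasDerivAt (fun τ : ℝ => x + τ • v) v τ := by
    intro τ
    have := ((hasDerivAt_id τ).smul_const v).const_add x
    simpa using this
  refine ⟨fun τ => fderiv ℝ f (x + τ • v) v, ?_, ?_⟩
  · have hev : ∀ᶠ y in 𝓝 x, DifferentiableAt ℝ f y :=
      (hf.eventually (by simp)).mono fun y hy => hy.differentiableAt (by norm_num)
    have hc : Tendsto (fun τ : ℝ => x + τ • v) (𝓝 0) (𝓝 x) := by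
      have := (hl 0).continuousAt.tendsto
      simpa using this
    filter_upwards [hc.eventually hev] with τ hτ
    exact hτ.hasFDerivAt.comp_hasDerivAt τ (hl τ)
  · have hd : DifferentiableAt ℝ (fderiv ℝ f) (x + (0:ℝ) • v) := by
      simpa using (hf.fderiv_right (m := 1) (by norm_num)).differentiableAt (by norm_num)
    have h1 := hd.hasFDerivAt.comp_hasDerivAt (0:ℝ) (hl 0)
    have h2 := h1.clm_apply (hasDerivAt_const (0:ℝ) v)
    rw [← Hs_quad f x hf]
    simpa using h2

lemma trace_form {n : ℕ} (A H : Fin n → Fin n → ℝ) (z : Fin n → ℝ) (α β : ℝ)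
    (hA : ∀ ξ : Fin n → ℝ, 0 ≤ ∑ i, ∑ j, A i j * ξ i * ξ j)
    (hs : ∀ i j, H i j = H j i)
    (hM : ∀ ξ : Fin n → ℝ, 0 ≤ ∑ i, ∑ j, H i j * ξ i * ξ j - α * (∑ i, z i * ξ i) ^ 2
      + β * ∑ i, ξ i ^ 2) :
    0 ≤ ∑ i, ∑ j, A i j * H i j - α * ∑ i, ∑ j, A i j * z i * z j + β * ∑ i, A i i := by
  have h := trace_nonneg A (fun i j => H i j - α * (z i * z j) + β * (if i = j then 1 else 0)) hA
    (by intro i j; simp only [hs i j, eq_comm (a := i), mul_comm (z i)])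
    (by
      intro ξ
      refine (hM ξ).trans_eq ?_
      simp only [add_mul, sub_mul, Finset.sum_add_distrib, Finset.sum_sub_distrib]
      congr 1
      · congr 1
        rw [sq, Finset.sum_mul_sum, Finset.mul_sum]
        refine Finset.sum_congr rfl fun i _ => ?_
        rw [Finset.mul_sum]
        refine Finset.sum_congr rfl fun j _ => ?_
        ring
      · rw [Finset.mul_sum]
        refine Finset.sum_congr rfl fun i _ => ?_
        rw [Finset.sum_eq_single i] <;> simp +contextual [eq_comm]
        ring)
  refine h.trans_eq ?_
  simp only [mul_add, mul_sub, Finset.sum_add_distrib, Finset.sum_sub_distrib]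
  congr 1
  · congr 1
    rw [Finset.mul_sum]
    refine Finset.sum_congr rfl fun i _ => ?_
    rw [Finset.mul_sum]
    refine Finset.sum_congr rfl fun j _ => ?_
    ring
  · rw [Finset.mul_sum]
    refine Finset.sum_congr rfl fun i _ => ?_
    rw [Finset.sum_eq_single i] <;> simp +contextual [eq_comm]
    ring

/-- Bounded solutions, regular in `x` and `t` separately. -/
structure LSol {n : ℕ} (ν : ℝ) (a : E n × ℝ → Fin n → Fin n → ℝ) (u : E n → ℝ → ℝ) : Prop where
  ell : ∀ x t, 0 < t → ∀ ξ : Fin n → ℝ, ν * ∑ i, ξ i ^ 2 ≤ ∑ i, ∑ j, a (x, t) i j * ξ i * ξ j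
  bd : ∀ x t, 0 < t → ∀ i j, |a (x, t) i j| ≤ ν⁻¹
  ac : ∀ x t, 0 < t → ∀ i j, ContinuousAt (fun X => a X i j) (x, t)
  c2 : ∀ x t, 0 < t → ContDiffAt ℝ 2 (fun x => u x t) x
  dt : ∀ x t, 0 < t → HasDerivAt (u x) (∑ i, ∑ j, a (x, t) i j * Hs (fun x => u x t) x i j) t
  ub : ∀ x t, 0 < t → |u x t| ≤ 1

lemma Hs_neg {n : ℕ} (f : E n → ℝ) (x : E n) (i j : Fin n) :
    Hs (fun x => - f x) x i j = - Hs f x i j := by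
  unfold Hs
  have : (fun x => fderiv ℝ (fun x => - f x) x (EuclideanSpace.single j (1:ℝ))) =
      fun x => - (fderiv ℝ f x (EuclideanSpace.single j (1:ℝ))) := by
    ext y
    rw [fderiv_fun_neg]
    rfl
  rw [this, fderiv_fun_neg]
  rfl

lemma LSol.neg {n : ℕ} {ν : ℝ} {a : E n × ℝ → Fin n → Fin n → ℝ} {u : E n → ℝ → ℝ}
    (h : LSol ν a u) : LSol ν a (fun x t => - u x t) where
  ell := h.ell
  bd := h.bd
  ac := h.ac
  c2 x t ht := (h.c2 x t ht).neg
  dt x t ht := by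
    have := (h.dt x t ht).fun_neg
    simpa [Hs_neg] using this
  ub x t ht := by simpa using h.ub x t ht

lemma step_back (f : ℝ → ℝ) (d t0 t : ℝ) (h : HasDerivAt f d t) (hd : 0 < d) (ht : t0 < t) :
    ∃ s ∈ Ico t0 t, f s ≤ f t := by
  have h1 := (hasDerivAt_iff_tendsto_slope.1 h).eventually (lt_mem_nhds hd)
  have h2 : ∀ᶠ s in 𝓝[<] t, 0 < slope f t s :=
    h1.filter_mono (nhdsWithin_mono _ (fun s hs => ne_of_lt hs))
  have h3 : ∀ᶠ s in 𝓝[<] t, s ∈ Ioo t0 t := Ioo_mem_nhdsLT ht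
  obtain ⟨s, hs1, hs2⟩ := (h2.and h3).exists
  refine ⟨s, ⟨hs2.1.le, hs2.2⟩, ?_⟩
  rw [slope_def_field] at hs1
  have h4 : s - t < 0 := by linarith [hs2.2]
  by_contra hcon
  push Not at hcon
  have := div_neg_of_pos_of_neg (show 0 < f s - f t by linarith) h4
  linarith

/-- the exponent in the barrier -/
def Kc (n : ℕ) (ν : ℝ) : ℝ := (8 * ν + 4 * n / ν) ^ 2 / (16 * ν)

lemma Kc_nonneg (n : ℕ) (ν : ℝ) (hν : 0 < ν) : 0 ≤ Kc n ν := by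
  unfold Kc; positivity

lemma Kc_quad (n : ℕ) (ν w : ℝ) (hν : 0 < ν) :
    0 < 8 * ν * (1 - w) - 4 * w * (n / ν) + Kc n ν * w ^ 2 := by
  have : 8 * ν * (1 - w) - 4 * w * (n / ν) + Kc n ν * w ^ 2 =
      ((8 * ν + 4 * n / ν) * w - 8 * ν) ^ 2 / (16 * ν) + 4 * ν := by
    unfold Kc
    field_simp
    ring
  rw [this]
  positivity

lemma norm_line {n : ℕ} (z v : E n) (τ : ℝ) :
    ‖z + τ • v‖ ^ 2 = ‖z‖ ^ 2 + 2 * (∑ i, z i * v i) * τ + (∑ i, v i ^ 2) * τ ^ 2 := by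
  simp only [EuclideanSpace.norm_sq_eq, Real.norm_eq_abs, sq_abs, PiLp.add_apply, PiLp.smul_apply,
    smul_eq_mul, Finset.mul_sum, Finset.sum_mul, ← Finset.sum_add_distrib]
  refine Finset.sum_congr rfl fun i _ => ?_
  ring

/-- second order condition for the barrier -/
lemma barrier_second {n : ℕ} (f : E n → ℝ) (x y : E n) (hf : ContDiffAt ℝ 2 f x) (c M ρ : ℝ)
    (hmin : IsLocalMin (fun x' => f x' - (M + c * (1 - ‖x' - y‖ ^ 2 / ρ ^ 2) ^ 2)) x) (v : E n) :
    0 ≤ ∑ i, ∑ j, Hs f x i j * v i * v j - (8 * c / ρ ^ 4) * (∑ i, (x - y) i * v i) ^ 2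
      + (4 * c * (1 - ‖x - y‖ ^ 2 / ρ ^ 2) / ρ ^ 2) * ∑ i, v i ^ 2 := by
  obtain ⟨h1, hd, hd2⟩ := line_deriv f x hf v
  set b := ∑ i, (x - y) i * v i with hb
  set cc := ∑ i, v i ^ 2 with hcc
  set q := ‖x - y‖ ^ 2 with hq
  set P : ℝ → ℝ := fun τ => 1 - (q + 2 * b * τ + cc * τ ^ 2) / ρ ^ 2 with hP
  have hPd : ∀ τ, HasDerivAt P (-((2 * b + cc * (2 * τ)) / ρ ^ 2)) τ := by
    intro τ
    have e1 : HasDerivAt (fun τ : ℝ => q + 2 * b * τ + cc * τ ^ 2) (2 * b + cc * (2 * τ)) τ := by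
      have := (((hasDerivAt_id τ).const_mul (2 * b)).const_add q).fun_add
        ((hasDerivAt_pow 2 τ).const_mul cc)
      simpa using this
    simpa using (e1.div_const (ρ ^ 2)).const_sub 1
  have key := second_deriv_nonneg
    (fun τ => f (x + τ • v) - (M + c * (P τ) ^ 2))
    (fun τ => h1 τ - c * (2 * P τ * (-((2 * b + cc * (2 * τ)) / ρ ^ 2))))
    _ ?_ (hd2.sub (((((hPd 0).const_mul 2).mul (?_ : HasDerivAt
      (fun τ : ℝ => -((2 * b + cc * (2 * τ)) / ρ ^ 2)) (-((cc * 2) / ρ ^ 2)) 0))).const_mul c)) ?_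
  · refine key.trans_eq ?_
    simp only [hP]
    by_cases hρ : ρ = 0
    · simp [hρ]
    field_simp
    ring
  · filter_upwards [hd] with τ hτ
    have e2 := ((hPd τ).pow 2).const_mul c |>.const_add M
    have := hτ.fun_sub e2
    simpa using this
  · have := (((((hasDerivAt_id (0:ℝ)).const_mul 2).const_mul cc).const_add (2 * b)).div_const
      (ρ ^ 2)).fun_neg
    simpa using this
  · have hc : Tendsto (fun τ : ℝ => x + τ • v) (𝓝 0) (𝓝 x) := by
      have : Continuous (fun τ : ℝ => x + τ • v) := by fun_prop
      simpa using this.tendsto 0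
    have := hc.eventually hmin
    unfold IsLocalMin IsMinFilter
    filter_upwards [this] with τ hτ
    have e : x + τ • v - y = (x - y) + τ • v := by abel
    rw [e, norm_line] at hτ
    simp only [hP, mul_zero, zero_smul, add_zero]
    simpa [hb, hcc, hq] using hτ

lemma RL.sub_cont {α : Type*} [TopologicalSpace α] {u v : α → ℝ → ℝ} {x : α} {t : ℝ}
    (hu : RL u x t) (hv : ContinuousAt (fun p : α × ℝ => v p.1 p.2) (x, t)) :
    RL (fun x t => u x t - v x t) x t := by
  intro ε hε
  have h1 := hu (ε / 2) (by linarith)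
  have h2 : ∀ᶠ p in 𝓝 x ×ˢ 𝓝[>] t, v p.1 p.2 < v x t + ε / 2 := by
    have h3 : Tendsto (fun p : α × ℝ => v p.1 p.2) (𝓝 x ×ˢ 𝓝[>] t) (𝓝 (v x t)) := by
      have := hv.tendsto
      rw [nhds_prod_eq] at this
      exact this.mono_left (Filter.prod_mono le_rfl nhdsWithin_le_nhds)
    exact h3.eventually (gt_mem_nhds (by linarith))
  filter_upwards [h1, h2] with p a b
  linarith

lemma barrier {n : ℕ} {ν : ℝ} {a : E n × ℝ → Fin n → Fin n → ℝ} {u : E n → ℝ → ℝ}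
    (hν : 0 < ν) (h : LSol ν a u) (y : E n) (ρ α s M η : ℝ) (hρ : 0 < ρ) (hα : 0 ≤ α)
    (hαs : α ≤ s) (hη : 0 ≤ η)
    (hR : ∀ t ∈ Ico α s, ∀ x ∈ closedBall y ρ, RL u x t)
    (hM : ∀ t ∈ Ioc α s, ∀ x ∈ closedBall y ρ, M ≤ u x t)
    (h0 : ∀ x ∈ closedBall y ρ, M + η ≤ u x α) :
    M + η * Real.exp (-(Kc n ν * (s - α) / ρ ^ 2)) ≤ u y s := by
  have hyb : y ∈ closedBall y ρ := mem_closedBall_self hρ.le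
  rcases hαs.eq_or_lt with rfl | hlt
  · simpa using h0 y hyb
  rcases hη.eq_or_lt with rfl | hηp
  · simpa using hM s ⟨hlt, le_rfl⟩ y hyb
  set Ec : ℝ → ℝ := fun t => Real.exp (-(Kc n ν * (t - α) / ρ ^ 2)) with hEc
  have hE0 : ∀ t, 0 < Ec t := fun t => Real.exp_pos _
  set V : E n → ℝ → ℝ := fun x t => M + η * Ec t * (1 - ‖x - y‖ ^ 2 / ρ ^ 2) ^ 2 with hV
  have hVc : Continuous (fun p : E n × ℝ => V p.1 p.2) := by
    simp only [hV, hEc]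
    fun_prop
  have hw : ∀ x ∈ closedBall y ρ, 0 ≤ 1 - ‖x - y‖ ^ 2 / ρ ^ 2 ∧ 1 - ‖x - y‖ ^ 2 / ρ ^ 2 ≤ 1 := by
    intro x hx
    rw [mem_closedBall, dist_eq_norm] at hx
    have h1 : ‖x - y‖ ^ 2 / ρ ^ 2 ≤ 1 := by
      rw [div_le_one (by positivity)]
      gcongr
    have h2 : 0 ≤ ‖x - y‖ ^ 2 / ρ ^ 2 := by positivity
    constructor <;> linarith
  have main := abstract_min (closedBall y ρ) (isCompact_closedBall y ρ)
    (fun x t => u x t - V x t) α s ?_ ?_ ?_ ?_ s ⟨hαs, le_rfl⟩ y hyb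
  · simp only [hV, hEc, sub_self, norm_zero] at main
    norm_num at main
    linarith
  · intro t ht
    have ht0 : 0 < t := hα.trans_lt ht.1
    have h1 : Continuous fun x => u x t :=
      continuous_iff_continuousAt.2 fun x => (h.c2 x t ht0).continuousAt
    have h2 : Continuous fun x => V x t := hVc.comp (by fun_prop : Continuous fun x : E n => (x, t))
    exact (h1.sub h2).continuousOn
  · intro t ht x hx
    exact (hR t ht x hx).sub_cont hVc.continuousAt
  · intro x hx
    have h1 := h0 x hx
    have h2 := hw x hx
    have h3 : (1 - ‖x - y‖ ^ 2 / ρ ^ 2) ^ 2 ≤ 1 := by nlinarith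
    have h4 : Ec α = 1 := by simp [hEc]
    simp only [hV, h4, mul_one]
    nlinarith
  · intro t ht x hx hmin hneg
    have ht0 : 0 < t := hα.trans_lt ht.1
    have hxlt : x ∈ ball y ρ := by
      rw [mem_ball]
      refine lt_of_le_of_ne hx fun heq => ?_
      have h1 := hM t ht x hx
      rw [dist_eq_norm] at heq
      have : V x t = M := by
        simp only [hV, heq]
        rw [div_self (by positivity)]
        ring
      linarith
    have hloc : IsLocalMin (fun x' => u x' t - (M + η * Ec t * (1 - ‖x' - y‖ ^ 2 / ρ ^ 2) ^ 2)) x := by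
      filter_upwards [isOpen_ball.mem_nhds hxlt] with x' hx'
      exact hmin x' (ball_subset_closedBall hx')
    set w := 1 - ‖x - y‖ ^ 2 / ρ ^ 2 with hwdef
    have hw0 := (hw x hx).1
    set cη := η * Ec t with hcη
    have hc0 : 0 < cη := mul_pos hηp (hE0 t)
    have hsec := barrier_second (fun x => u x t) x y (h.c2 x t ht0) cη M ρ hloc
    have htr := trace_form (a (x, t)) (Hs (fun x => u x t) x) (fun i => (x - y) i)
      (8 * cη / ρ ^ 4) (4 * cη * w / ρ ^ 2)
      (fun ξ => le_trans (by positivity) (h.ell x t ht0 ξ))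
      (Hs_symm _ x (h.c2 x t ht0)) (fun ξ => hsec (WithLp.toLp 2 ξ))
    have hell := h.ell x t ht0 (fun i => (x - y) i)
    have hnorm : ∑ i, ((x - y) i) ^ 2 = ρ ^ 2 * (1 - w) := by
      have : ∑ i, ((x - y) i) ^ 2 = ‖x - y‖ ^ 2 := by
        simp [EuclideanSpace.norm_sq_eq]
      rw [this, hwdef]
      field_simp
      ring
    rw [hnorm] at hell
    have htrace : ∑ i, a (x, t) i i ≤ n / ν := by
      calc ∑ i, a (x, t) i i ≤ ∑ _i : Fin n, ν⁻¹ :=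
            Finset.sum_le_sum fun i _ => (le_abs_self _).trans (h.bd x t ht0 i i)
        _ = n / ν := by simp [div_eq_mul_inv]
    have hVt : HasDerivAt (fun t => V x t) (-(Kc n ν / ρ ^ 2) * cη * w ^ 2) t := by
      have e1 : HasDerivAt (fun t => -(Kc n ν * (t - α) / ρ ^ 2)) (-(Kc n ν / ρ ^ 2)) t := by
        have := ((((hasDerivAt_id t).sub_const α).const_mul (Kc n ν)).div_const (ρ ^ 2)).fun_neg
        simpa using this
      have := ((e1.exp.const_mul η).mul_const (w ^ 2)).const_add M
      exact this.congr_deriv (by simp only [hcη, hEc]; ring)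
    refine step_back (fun t => u x t - V x t) _ α t ((h.dt x t ht0).fun_sub hVt) ?_ ht.1
    have hq := mul_pos (div_pos hc0 (show 0 < ρ ^ 2 by positivity)) (Kc_quad n ν w hν)
    have b1 := mul_le_mul_of_nonneg_left hell (show 0 ≤ 8 * cη / ρ ^ 4 by positivity)
    have b2 := mul_le_mul_of_nonneg_left htrace (show 0 ≤ 4 * cη * w / ρ ^ 2 by positivity)
    have e3 : 8 * cη / ρ ^ 4 * (ν * (ρ ^ 2 * (1 - w))) - 4 * cη * w / ρ ^ 2 * (n / ν)
        - (-(Kc n ν / ρ ^ 2) * cη * w ^ 2)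
        = cη / ρ ^ 2 * (8 * ν * (1 - w) - 4 * w * (n / ν) + Kc n ν * w ^ 2) := by
      field_simp
      ring
    linarith

lemma holder_trace {n : ℕ} (hn : 1 ≤ n) (ν : ℝ) (hν : 0 < ν) (A B H1 H2 : Fin n → Fin n → ℝ)
    (z : Fin n → ℝ) (q κ k : ℝ) (hq : 0 < q) (hκ : 0 ≤ κ) (hk : 0 ≤ k)
    (hz : ∑ i, z i ^ 2 = q)
    (s1 : ∀ i j, H1 i j = H1 j i) (s2 : ∀ i j, H2 i j = H2 j i)
    (ell : ∀ ξ : Fin n → ℝ, ν * ∑ i, ξ i ^ 2 ≤ ∑ i, ∑ j, A i j * ξ i * ξ j)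
    (bd : ∀ i j, |A i j| ≤ ν⁻¹)
    (osc : ∀ i j, |B i j - A i j| ≤ ν / (6 * n ^ 2))
    (hH : ∀ v w : Fin n → ℝ, ∑ i, ∑ j, H1 i j * v i * v j - ∑ i, ∑ j, H2 i j * w i * w j ≤
      κ * (1 / 2 * ∑ i, (v i - w i) ^ 2 - 3 / 4 * (∑ i, z i * (v i - w i)) ^ 2 / q)
        + 2 * k * (∑ i, v i ^ 2 + ∑ i, w i ^ 2)) :
    ∑ i, ∑ j, A i j * H1 i j - ∑ i, ∑ j, B i j * H2 i j ≤
      - κ * ν / 4 + k * (4 * n / ν + 3 * ν) := by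
  have hn0 : (0:ℝ) < n := by exact_mod_cast hn
  have hn1 : (1:ℝ) ≤ n := by exact_mod_cast hn
  set lam := ν / (6 * n) with hlam
  have hlam0 : 0 < lam := by positivity
  have hlamn : lam * n = ν / 6 := by rw [hlam]; field_simp
  have hlamν : lam ≤ ν / 6 := by nlinarith
  set th := ν / (6 * (n:ℝ) ^ 2) with hth
  have hth0 : 0 < th := by positivity
  have hthn : th * n = lam := by rw [hth, hlam]; field_simp
  -- sums with identity matrix
  have hid : ∀ (c : ℝ) (M : Fin n → Fin n → ℝ),
      ∑ i, ∑ j, (c * if i = j then (1:ℝ) else 0) * M i j = c * ∑ i, M i i := by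
    intro c M
    rw [Finset.mul_sum]
    refine Finset.sum_congr rfl fun i _ => ?_
    rw [Finset.sum_eq_single i] <;> simp +contextual [eq_comm]
  have hidq : ∀ (c : ℝ) (ξ : Fin n → ℝ),
      ∑ i, ∑ j, (c * if i = j then (1:ℝ) else 0) * ξ i * ξ j = c * ∑ i, ξ i ^ 2 := by
    intro c ξ
    have := hid c (fun i j => ξ i * ξ j)
    simp only [← mul_assoc] at this
    rw [this]
    simp [sq]
  have hzz : ∀ (c : ℝ) (M : Fin n → Fin n → ℝ),
      ∑ i, ∑ j, (c * (z i * z j)) * M i j = c * ∑ i, ∑ j, M i j * z i * z j := by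
    intro c M
    simp only [Finset.mul_sum]
    refine Finset.sum_congr rfl fun i _ => Finset.sum_congr rfl fun j _ => ?_
    ring
  have hzzq : ∀ (c : ℝ) (ξ : Fin n → ℝ),
      ∑ i, ∑ j, (c * (z i * z j)) * ξ i * ξ j = c * (∑ i, z i * ξ i) ^ 2 := by
    intro c ξ
    rw [sq, Finset.sum_mul_sum]
    simp only [Finset.mul_sum]
    refine Finset.sum_congr rfl fun i _ => Finset.sum_congr rfl fun j _ => ?_
    ring
  have hCS : ∀ ξ : Fin n → ℝ, (∑ i, z i * ξ i) ^ 2 ≤ q * ∑ i, ξ i ^ 2 := by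
    intro ξ
    have := Finset.sum_mul_sq_le_sq_mul_sq Finset.univ z ξ
    rwa [hz] at this
  -- the three pieces
  have p1 := trace_form
    (fun i j => A i j - (ν / (2 * q)) * (z i * z j) - lam * (if i = j then 1 else 0))
    (fun i j => H2 i j - H1 i j) z 0 (4 * k)
    (by
      intro ξ
      simp only [sub_mul, Finset.sum_sub_distrib]
      rw [hidq, hzzq]
      have e1 := ell ξ
      have e2 := mul_le_mul_of_nonneg_left (hCS ξ) (show 0 ≤ ν / (2 * q) by positivity)
      have e3 : ν / (2 * q) * (q * ∑ i, ξ i ^ 2) = ν / 2 * ∑ i, ξ i ^ 2 := by field_simp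
      have e4 : 0 ≤ ∑ i, ξ i ^ 2 := by positivity
      nlinarith)
    (by intro i j; simp only [s1 i j, s2 i j])
    (by
      intro ξ
      have := hH ξ ξ
      simp only [sub_mul, Finset.sum_sub_distrib]
      simp at this
      linarith)
  have p2 := trace_form (fun i j => lam * (if i = j then 1 else 0)) (fun i j => - H1 i j) z 0
    (κ / 2 + 2 * k)
    (by intro ξ; rw [hidq]; positivity)
    (by intro i j; simp only [s1 i j])
    (by
      intro ξ
      have := hH ξ 0
      have e1 : 0 ≤ κ * (3 / 4 * (∑ i, z i * ξ i) ^ 2 / q) := by positivity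
      simp at this
      simp only [neg_mul, Finset.sum_neg_distrib]
      linarith)
  have p3 := trace_form (fun i j => lam * (if i = j then 1 else 0) + (B i j - A i j)) H2 z 0
    (κ / 2 + 2 * k)
    (by
      intro ξ
      have e0 : ∀ i j, (lam * (if i = j then (1:ℝ) else 0) + (B i j - A i j)) * ξ i * ξ j =
          (lam * (if i = j then (1:ℝ) else 0)) * ξ i * ξ j + (B i j - A i j) * ξ i * ξ j := by
        intro i j; ring
      simp only [e0, Finset.sum_add_distrib]
      rw [hidq]
      have e1 : |∑ i, ∑ j, (B i j - A i j) * ξ i * ξ j| ≤ th * (∑ i, |ξ i|) ^ 2 := by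
        rw [sq, Finset.sum_mul_sum, Finset.mul_sum]
        refine (Finset.abs_sum_le_sum_abs _ _).trans (Finset.sum_le_sum fun i _ => ?_)
        rw [Finset.mul_sum]
        refine (Finset.abs_sum_le_sum_abs _ _).trans (Finset.sum_le_sum fun j _ => ?_)
        rw [abs_mul, abs_mul, mul_assoc]
        exact mul_le_mul_of_nonneg_right (osc i j) (by positivity)
      have e2 : (∑ i, |ξ i|) ^ 2 ≤ n * ∑ i, ξ i ^ 2 := by
        have := sq_sum_le_card_mul_sum_sq (s := Finset.univ) (f := fun i => |ξ i|)
        simpa using this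
      have e3 := mul_le_mul_of_nonneg_left e2 hth0.le
      rw [← mul_assoc, hthn] at e3
      have := (abs_le.1 (e1.trans e3)).1
      linarith)
    s2
    (by
      intro ξ
      have := hH 0 ξ
      have e1 : 0 ≤ κ * (3 / 4 * (∑ i, z i * ξ i) ^ 2 / q) := by positivity
      simp at this
      linarith)
  have p4 : ∑ i, ∑ j, H1 i j * z i * z j - ∑ i, ∑ j, H2 i j * z i * z j ≤ q * (-κ + 4 * k) := by
    have := hH z (fun i => - z i)
    have e1 : ∑ i, (z i - - z i) ^ 2 = 4 * q := by
      rw [← hz, Finset.mul_sum]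
      exact Finset.sum_congr rfl fun i _ => by ring
    have e2 : ∑ i, z i * (z i - - z i) = 2 * q := by
      rw [← hz, Finset.mul_sum]
      exact Finset.sum_congr rfl fun i _ => by ring
    rw [e1, e2] at this
    have e3 : ∑ i, ∑ j, H2 i j * - z i * - z j = ∑ i, ∑ j, H2 i j * z i * z j :=
      Finset.sum_congr rfl fun i _ => Finset.sum_congr rfl fun j _ => by ring
    rw [e3] at this
    have e4 : 3 / 4 * (2 * q) ^ 2 / q = 3 * q := by field_simp; ring
    rw [e4] at this
    simp only [neg_sq, hz] at this
    linarith
  have p4' := mul_le_mul_of_nonneg_left p4 (show 0 ≤ ν / (2 * q) by positivity)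
  have e5 : ν / (2 * q) * (q * (-κ + 4 * k)) = ν / 2 * (-κ + 4 * k) := by field_simp
  rw [e5] at p4'
  have trA : ∑ i, A i i ≤ n / ν := by
    calc ∑ i, A i i ≤ ∑ _i : Fin n, ν⁻¹ :=
          Finset.sum_le_sum fun i _ => (le_abs_self _).trans (bd i i)
      _ = n / ν := by simp [div_eq_mul_inv]
  have trBA : ∑ i, (B i i - A i i) ≤ lam := by
    calc ∑ i, (B i i - A i i) ≤ ∑ _i : Fin n, th :=
          Finset.sum_le_sum fun i _ => (le_abs_self _).trans (osc i i)
      _ = lam := by rw [← hthn]; simp [mul_comm]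
  simp only [sub_mul, mul_sub, Finset.sum_sub_distrib, hid, hzz, zero_mul, sub_zero] at p1
  simp only [hid, mul_neg, Finset.sum_neg_distrib, zero_mul, sub_zero] at p2
  simp only [add_mul, sub_mul, Finset.sum_add_distrib, Finset.sum_sub_distrib, hid, zero_mul,
    sub_zero] at p3
  simp at p1 p2 p3
  have hzz' : ∑ i, ν / (2 * q) * (z i * z i) = ν / 2 := by
    rw [← Finset.mul_sum]
    have : ∑ i, z i * z i = q := by rw [← hz]; exact Finset.sum_congr rfl fun i _ => by ring
    rw [this]; field_simp
  rw [hzz'] at p1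
  rw [Finset.sum_sub_distrib] at trBA
  have hnl : (n:ℝ) * lam = ν / 6 := by rw [mul_comm]; exact hlamn
  rw [hnl] at p1 p2 p3
  have f1 := mul_le_mul_of_nonneg_left trA hk
  have f2 : k * (4 * n / ν + 3 * ν) = 4 * (k * (n / ν)) + 3 * (k * ν) := by ring
  have f3 : (κ / 2 + 2 * k) * (ν / 6 + (∑ x, B x x - ∑ x, A x x)) ≤
      (κ / 2 + 2 * k) * (ν / 6 + ν / 6) :=
    mul_le_mul_of_nonneg_left (by linarith) (by positivity)
  have f4 : 0 ≤ k * ν := by positivity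
  rw [f2]
  linarith


lemma holder_second {n : ℕ} (f : E n → ℝ) (x y x0 : E n) (hfx : ContDiffAt ℝ 2 f x)
    (hfy : ContDiffAt ℝ 2 f y) (D k c : ℝ) (hne : x ≠ y)
    (hmin : IsLocalMin (fun p : E n × E n => D * (‖p.1 - p.2‖ ^ 2) ^ (1 / 4 : ℝ) +
      k * (‖p.1 - x0‖ ^ 2 + ‖p.2 - x0‖ ^ 2) + c - (f p.1 - f p.2)) (x, y)) (v w : E n) :
    ∑ i, ∑ j, Hs f x i j * v i * v j - ∑ i, ∑ j, Hs f y i j * w i * w j ≤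
      (D * (‖x - y‖ ^ 2) ^ (-(3 / 4) : ℝ)) * (1 / 2 * ∑ i, (v i - w i) ^ 2
        - 3 / 4 * (∑ i, (x - y) i * (v i - w i)) ^ 2 / ‖x - y‖ ^ 2)
        + 2 * k * (∑ i, v i ^ 2 + ∑ i, w i ^ 2) := by
  obtain ⟨hx1, hdx, hdx2⟩ := line_deriv f x hfx v
  obtain ⟨hy1, hdy, hdy2⟩ := line_deriv f y hfy w
  set Sx := ∑ i, ∑ j, Hs f x i j * v i * v j
  set Sy := ∑ i, ∑ j, Hs f y i j * w i * w j
  set q := ‖x - y‖ ^ 2 with hq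
  have hq0 : 0 < q := by
    have : 0 < ‖x - y‖ := norm_pos_iff.2 (sub_ne_zero.2 hne)
    positivity
  set b := ∑ i, (x - y) i * (v i - w i) with hb
  set cc := ∑ i, (v i - w i) ^ 2 with hcc
  set p : ℝ → ℝ := fun τ => q + 2 * b * τ + cc * τ ^ 2 with hp
  set p1 : ℝ → ℝ := fun τ => 2 * b + cc * (2 * τ) with hp1
  have quad : ∀ A B C τ : ℝ, HasDerivAt (fun τ : ℝ => A + 2 * B * τ + C * τ ^ 2)
      (2 * B + C * (2 * τ)) τ := by
    intro A B C τ
    have := (((hasDerivAt_id τ).const_mul (2 * B)).const_add A).fun_add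
      (((hasDerivAt_id τ).fun_pow 2).const_mul C)
    refine this.congr_deriv ?_
    simp
  have lin : ∀ B C τ : ℝ, HasDerivAt (fun τ : ℝ => 2 * B + C * (2 * τ)) (2 * C) τ := by
    intro B C τ
    have := (((hasDerivAt_id τ).const_mul 2).const_mul C).const_add (2 * B)
    refine this.congr_deriv ?_
    ring
  have hpd : ∀ τ, HasDerivAt p (p1 τ) τ := fun τ => quad q b cc τ
  have hp0 : p 0 = q := by simp [hp]
  have hp10 : p1 0 = 2 * b := by simp [hp1]
  have hpev : ∀ᶠ τ in 𝓝 (0:ℝ), 0 < p τ :=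
    (hpd 0).continuousAt.eventually (lt_mem_nhds (by rw [hp0]; exact hq0))
  set bx := ∑ i, (x - x0) i * v i with hbx
  set byw := ∑ i, (y - x0) i * w i with hby
  set cx := ∑ i, v i ^ 2 with hcx
  set cy := ∑ i, w i ^ 2 with hcy
  have hH := second_deriv_nonneg
    (fun τ => D * (p τ) ^ (1 / 4 : ℝ) +
      k * ((‖x - x0‖ ^ 2 + 2 * bx * τ + cx * τ ^ 2) + (‖y - x0‖ ^ 2 + 2 * byw * τ + cy * τ ^ 2))
      + c - (f (x + τ • v) - f (y + τ • w)))
    (fun τ => D * (p1 τ * (1 / 4) * (p τ) ^ (1 / 4 - 1 : ℝ)) +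
      k * ((2 * bx + cx * (2 * τ)) + (2 * byw + cy * (2 * τ))) - (hx1 τ - hy1 τ))
    (D * (2 * cc * (1 / 4) * q ^ (1 / 4 - 1 : ℝ)
      + 2 * b * (1 / 4) * (2 * b * (1 / 4 - 1) * q ^ (1 / 4 - 1 - 1 : ℝ)))
      + k * (2 * cx + 2 * cy) - (Sx - Sy))
    (by
      filter_upwards [hpev, hdx, hdy] with τ h1 h2 h3
      have e1 := ((hpd τ).rpow_const (p := (1 / 4 : ℝ)) (Or.inl h1.ne')).const_mul D
      have e2 := ((quad (‖x - x0‖ ^ 2) bx cx τ).fun_add (quad (‖y - x0‖ ^ 2) byw cy τ)).const_mul k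
      exact ((e1.fun_add e2).add_const c).fun_sub (h2.fun_sub h3))
    (by
      have e0 := (hpd 0).rpow_const (p := (1 / 4 - 1 : ℝ)) (Or.inl (by rw [hp0]; exact hq0.ne'))
      have e1 := (((lin b cc 0).mul_const (1 / 4)).fun_mul e0).const_mul D
      have e2 := ((lin bx cx 0).fun_add (lin byw cy 0)).const_mul k
      have e3 := (e1.fun_add e2).fun_sub (hdx2.fun_sub hdy2)
      refine e3.congr_deriv ?_
      rw [hp0, hp10]
      simp)
    (by
      have hc : ContinuousAt (fun τ : ℝ => ((x + τ • v, y + τ • w) : E n × E n)) 0 := by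
        fun_prop
      have hc' : Tendsto (fun τ : ℝ => ((x + τ • v, y + τ • w) : E n × E n)) (𝓝 0)
          (𝓝 (x, y)) := by
        have := hc.tendsto
        simpa using this
      have hm2 := hc'.eventually hmin
      refine hm2.mono fun τ hτ => ?_
      have g1 := norm_line (x - x0) v τ
      have g2 := norm_line (y - x0) w τ
      have g3 := norm_line (x - y) (v - w) τ
      have i1 : x + τ • v - x0 = x - x0 + τ • v := by abel
      have i2 : y + τ • w - x0 = y - x0 + τ • w := by abel
      have i3 : x + τ • v - (y + τ • w) = x - y + τ • (v - w) := by rw [smul_sub]; abel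
      simp only [i1, i2, i3, g1, g2, g3] at hτ
      simpa [hp, hq, hb, hcc, hbx, hby, hcx, hcy] using hτ)
  have r1 : (1 / 4 - 1 : ℝ) = -(3 / 4) := by norm_num
  have r2 : q ^ (1 / 4 - 1 - 1 : ℝ) = q ^ (-(3 / 4) : ℝ) / q := by
    rw [Real.rpow_sub hq0, Real.rpow_one, r1]
  rw [r2, r1] at hH
  have : D * (2 * cc * (1 / 4) * q ^ (-(3 / 4) : ℝ)
      + 2 * b * (1 / 4) * (2 * b * (-(3 / 4)) * (q ^ (-(3 / 4) : ℝ) / q))) =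
      (D * q ^ (-(3 / 4) : ℝ)) * (1 / 2 * cc - 3 / 4 * b ^ 2 / q) := by
    field_simp
    ring
  rw [this] at hH
  linarith

def Hc (n : ℕ) (ν : ℝ) : ℝ := 16 / ν * (8 * n / ν + 6 * ν + 3)

lemma Hc_pos (n : ℕ) (ν : ℝ) (hν : 0 < ν) : 0 < Hc n ν := by
  unfold Hc; positivity

lemma RL.diff {α : Type*} [TopologicalSpace α] {u : α → ℝ → ℝ} {x y : α} {t : ℝ}
    (hx : RL (fun x t => - u x t) x t) (hy : RL u y t) :
    RL (fun (p : α × α) t => - u p.1 t + u p.2 t) (x, y) t := by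
  intro ε hε
  have h1 : Tendsto (fun p : (α × α) × ℝ => (p.1.1, p.2)) (𝓝 (x, y) ×ˢ 𝓝[>] t)
      (𝓝 x ×ˢ 𝓝[>] t) :=
    (((continuous_fst.tendsto (x, y)).comp tendsto_fst)).prodMk tendsto_snd
  have h2 : Tendsto (fun p : (α × α) × ℝ => (p.1.2, p.2)) (𝓝 (x, y) ×ˢ 𝓝[>] t)
      (𝓝 y ×ˢ 𝓝[>] t) :=
    (((continuous_snd.tendsto (x, y)).comp tendsto_fst)).prodMk tendsto_snd
  filter_upwards [h1.eventually (hx (ε / 2) (by linarith)),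
    h2.eventually (hy (ε / 2) (by linarith))] with p e1 e2
  change - u x t - _ < - u p.1.1 p.2 at e1
  change u y t - _ < u p.1.2 p.2 at e2
  change (- u x t + u y t) - ε < - u p.1.1 p.2 + u p.1.2 p.2
  linarith

lemma LSol.cont {n : ℕ} {ν : ℝ} {a : E n × ℝ → Fin n → Fin n → ℝ} {u : E n → ℝ → ℝ}
    (h : LSol ν a u) {t : ℝ} (ht : 0 < t) : Continuous (fun x => u x t) :=
  continuous_iff_continuousAt.2 fun x => (h.c2 x t ht).continuousAt

lemma holder_interior {n : ℕ} (hn : 1 ≤ n) {ν : ℝ} {a : E n × ℝ → Fin n → Fin n → ℝ}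
    {u : E n → ℝ → ℝ} (hν : 0 < ν) (h : LSol ν a u) (x0 : E n) (σ t : ℝ) (hσ : 0 < σ)
    (ht0 : 0 < t) (x y : E n) (hx : x ∈ closedBall x0 √σ) (hy : y ∈ closedBall x0 √σ)
    (osc : ∀ i j, |a (y, t) i j - a (x, t) i j| ≤ ν / (6 * n ^ 2)) (D c : ℝ)
    (hD : D = Hc n ν * σ ^ (-(1 / 4) : ℝ)) (hD0 : 0 < D) (hne : x ≠ y)
    (hloc : IsLocalMin (fun p : E n × E n => D * (‖p.1 - p.2‖ ^ 2) ^ (1 / 4 : ℝ) +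
          2 / σ * (‖p.1 - x0‖ ^ 2 + ‖p.2 - x0‖ ^ 2) + c
            - ((fun x => u x t) p.1 - (fun x => u x t) p.2)) (x, y)) :
    ∑ i, ∑ j, a (x, t) i j * Hs (fun x => u x t) x i j
      - ∑ i, ∑ j, a (y, t) i j * Hs (fun x => u x t) y i j ≤ - (3 / σ) := by
  have hs := holder_second (fun x => u x t) x y x0 (h.c2 x t ht0) (h.c2 y t ht0) D (2 / σ)
    c hne hloc
  set q := ‖x - y‖ ^ 2 with hq
  have hq0 : 0 < q := by
    have : 0 < ‖x - y‖ := norm_pos_iff.2 (sub_ne_zero.2 hne)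
    positivity
  have hq4 : q ≤ 4 * σ := by
    have e1 : ‖x - y‖ ≤ 2 * √σ := by
      have := dist_triangle_right x y x0
      rw [mem_closedBall] at hx hy
      rw [← dist_eq_norm]; linarith
    have := pow_le_pow_left₀ (norm_nonneg _) e1 2
    rw [mul_pow, Real.sq_sqrt hσ.le] at this
    linarith
  set κ := D * q ^ (-(3 / 4) : ℝ) with hκ
  have hκ1 : Hc n ν / (4 * σ) ≤ κ := by
    have e1 : (4 * σ) ^ (-(3 / 4) : ℝ) ≤ q ^ (-(3 / 4) : ℝ) :=
      Real.rpow_le_rpow_of_nonpos hq0 hq4 (by norm_num)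
    have e2 : (4 * σ) ^ (-(1 / 4) : ℝ) ≤ σ ^ (-(1 / 4) : ℝ) :=
      Real.rpow_le_rpow_of_nonpos hσ (by linarith) (by norm_num)
    have e3 : (4 * σ) ^ (-(1 / 4) : ℝ) * (4 * σ) ^ (-(3 / 4) : ℝ) = (4 * σ)⁻¹ := by
      rw [← Real.rpow_add (by positivity), ← Real.rpow_neg_one]
      norm_num
    have e4 := mul_le_mul e2 e1 (by positivity) (by positivity)
    rw [e3] at e4
    have := mul_le_mul_of_nonneg_left e4 (Hc_pos n ν hν).le
    rw [hκ, hD, div_eq_mul_inv]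
    linarith
  have htr := holder_trace hn ν hν (a (x, t)) (a (y, t)) (Hs (fun x => u x t) x)
    (Hs (fun x => u x t) y) (fun i => (x - y) i) q κ (2 / σ) hq0 (by positivity) (by positivity)
    (by rw [hq, EuclideanSpace.norm_sq_eq]; simp)
    (Hs_symm _ _ (h.c2 x t ht0)) (Hs_symm _ _ (h.c2 y t ht0)) (h.ell x t ht0) (h.bd x t ht0)
    osc
    (fun v w => by simpa using hs (WithLp.toLp 2 v) (WithLp.toLp 2 w))
  have f1 : 3 / σ + 2 / σ * (4 * n / ν + 3 * ν) ≤ κ * ν / 4 := by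
    have : Hc n ν / (4 * σ) * ν / 4 = 3 / σ + 2 / σ * (4 * n / ν + 3 * ν) := by
      unfold Hc; field_simp; ring
    rw [← this]
    gcongr
  have f5 : -κ * ν / 4 = -(κ * ν / 4) := by ring
  rw [f5] at htr
  linarith

lemma holder {n : ℕ} (hn : 1 ≤ n) {ν : ℝ} {a : E n × ℝ → Fin n → Fin n → ℝ} {u : E n → ℝ → ℝ}
    (hν : 0 < ν) (h : LSol ν a u) (x0 : E n) (σ t1 : ℝ) (hσ : 0 < σ) (ht1 : 0 < t1)
    (hR : ∀ t ∈ Ico t1 (t1 + σ), ∀ x ∈ closedBall x0 √σ,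
      RL u x t ∧ RL (fun x t => - u x t) x t)
    (osc : ∀ t ∈ Icc t1 (t1 + σ), ∀ x ∈ closedBall x0 √σ, ∀ y ∈ closedBall x0 √σ, ∀ i j,
      |a (y, t) i j - a (x, t) i j| ≤ ν / (6 * n ^ 2)) :
    ∀ x ∈ closedBall x0 √σ, ∀ y ∈ closedBall x0 √σ,
      u x (t1 + σ) - u y (t1 + σ) ≤ Hc n ν * σ ^ (-(1 / 4) : ℝ) * (‖x - y‖ ^ 2) ^ (1 / 4 : ℝ) +
        2 / σ * (‖x - x0‖ ^ 2 + ‖y - x0‖ ^ 2) := by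
  set D := Hc n ν * σ ^ (-(1 / 4) : ℝ) with hD
  have hD0 : 0 < D := mul_pos (Hc_pos n ν hν) (Real.rpow_pos_of_pos hσ _)
  set K : Set (E n × E n) := closedBall x0 √σ ×ˢ closedBall x0 √σ with hK
  set v : E n × E n → ℝ → ℝ := fun p t => D * (‖p.1 - p.2‖ ^ 2) ^ (1 / 4 : ℝ) +
      2 / σ * (‖p.1 - x0‖ ^ 2 + ‖p.2 - x0‖ ^ 2) + 2 * (t1 + σ - t) / σ with hv
  have hvc : Continuous (fun q : (E n × E n) × ℝ => v q.1 q.2) := by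
    have e1 : Continuous (fun q : (E n × E n) × ℝ => (‖q.1.1 - q.1.2‖ ^ 2) ^ (1 / 4 : ℝ)) :=
      Continuous.rpow_const (by fun_prop) (fun _ => Or.inr (by norm_num))
    exact ((continuous_const.mul e1).add (by fun_prop)).add (by fun_prop)
  have hub : ∀ x y t, 0 < t → u x t - u y t ≤ 2 := by
    intro x y t ht
    have e1 := (abs_le.1 (h.ub x t ht)).2
    have e2 := (abs_le.1 (h.ub y t ht)).1
    linarith
  set g : E n × E n → ℝ → ℝ := fun p t => (- u p.1 t + u p.2 t) - (- v p t) with hg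
  have c1 : ∀ t ∈ Ioc t1 (t1 + σ), ContinuousOn (fun x => g x t) K := by
    intro t ht
    have ht0 : 0 < t := ht1.trans ht.1
    have e1 := h.cont ht0
    have e2 : Continuous (fun p => v p t) := 
      hvc.comp (g := fun q : (E n × E n) × ℝ => v q.1 q.2) (f := fun p => (p, t))
        (continuous_id.prodMk continuous_const)
    exact (((e1.comp continuous_fst).neg.add (e1.comp continuous_snd)).sub e2.neg).continuousOn
  have c2 : ∀ t ∈ Ico t1 (t1 + σ), ∀ x ∈ K, RL g x t := by
    rintro t ht ⟨x, y⟩ ⟨hx, hy⟩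
    exact RL.sub_cont (v := fun p t => - v p t) (RL.diff (hR t ht x hx).2 (hR t ht y hy).1)
      hvc.neg.continuousAt
  have c3 : ∀ x ∈ K, 0 ≤ g x t1 := by
    rintro ⟨x, y⟩ -
    have e1 := hub x y t1 ht1
    have e2 : 2 ≤ v (x, y) t1 := by
      have : 2 * (t1 + σ - t1) / σ = 2 := by field_simp; ring
      simp only [hv, this]
      have : 0 ≤ D * (‖x - y‖ ^ 2) ^ (1 / 4 : ℝ) +
        2 / σ * (‖x - x0‖ ^ 2 + ‖y - x0‖ ^ 2) := by positivity
      linarith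
    simp only [hg]
    linarith
  have c4 : ∀ t ∈ Ioc t1 (t1 + σ), ∀ x ∈ K, (∀ y ∈ K, g x t ≤ g y t) → g x t < 0 →
      ∃ s ∈ Ico t1 t, g x s ≤ g x t := by
    rintro t ht ⟨x, y⟩ ⟨hx, hy⟩ hmin hneg
    simp only at hx hy hneg hmin
    have ht0 : 0 < t := ht1.trans ht.1
    have hub' := hub x y t ht0
    have hA : 0 ≤ D * (‖x - y‖ ^ 2) ^ (1 / 4 : ℝ) := by positivity
    have hB : 0 ≤ 2 * (t1 + σ - t) / σ := div_nonneg (by linarith [ht.2]) hσ.le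
    have hC : ∀ w : E n, √σ ≤ ‖w‖ → 2 ≤ 2 / σ * ‖w‖ ^ 2 := by
      intro w hw
      have : σ ≤ ‖w‖ ^ 2 := by
        have := pow_le_pow_left₀ (Real.sqrt_nonneg σ) hw 2
        rwa [Real.sq_sqrt hσ.le] at this
      calc (2:ℝ) = 2 / σ * σ := by field_simp
        _ ≤ _ := mul_le_mul_of_nonneg_left this (by positivity)
    have hE : ∀ w : E n, 0 ≤ 2 / σ * ‖w‖ ^ 2 := fun w => by positivity
    have hx' : x ∈ ball x0 √σ := by
      rw [mem_ball, dist_eq_norm]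
      by_contra hcon
      have := hC _ (not_lt.1 hcon)
      have := hE (y - x0)
      simp only [hg, hv, mul_add] at hneg
      linarith
    have hy' : y ∈ ball x0 √σ := by
      rw [mem_ball, dist_eq_norm]
      by_contra hcon
      have := hC _ (not_lt.1 hcon)
      have := hE (x - x0)
      simp only [hg, hv, mul_add] at hneg
      linarith
    have hne : x ≠ y := by
      rintro rfl
      have := hE (x - x0)
      simp only [hg, hv, mul_add] at hneg
      linarith
    have hKn : K ∈ 𝓝 (x, y) := prod_mem_nhds
      (mem_of_superset (isOpen_ball.mem_nhds hx') ball_subset_closedBall)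
      (mem_of_superset (isOpen_ball.mem_nhds hy') ball_subset_closedBall)
    have hloc : IsLocalMin (fun p : E n × E n => D * (‖p.1 - p.2‖ ^ 2) ^ (1 / 4 : ℝ) +
        2 / σ * (‖p.1 - x0‖ ^ 2 + ‖p.2 - x0‖ ^ 2) + 2 * (t1 + σ - t) / σ
          - ((fun x => u x t) p.1 - (fun x => u x t) p.2)) (x, y) := by
      filter_upwards [hKn] with p hp
      have := hmin p hp
      simp only [hg, hv] at this ⊢
      linarith
    have htr := holder_interior hn hν h x0 σ t hσ ht0 x y hx hy
      (osc t ⟨ht.1.le, ht.2⟩ x hx y hy) D (2 * (t1 + σ - t) / σ) hD hD0 hne hloc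
    have hw : HasDerivAt (fun t => - v (x, y) t) (2 / σ) t := by
      have := ((((hasDerivAt_id t).const_sub (t1 + σ)).const_mul 2).div_const σ).const_add
          (D * (‖x - y‖ ^ 2) ^ (1 / 4 : ℝ) + 2 / σ * (‖x - x0‖ ^ 2 + ‖y - x0‖ ^ 2))
      refine this.fun_neg.congr_deriv ?_
      ring
    have hder := ((h.dt x t ht0).fun_neg.fun_add (h.dt y t ht0)).fun_sub hw
    refine step_back _ _ t1 t hder ?_ ht.1
    have f2 : 0 < 1 / σ := by positivity
    have f3 : 3 / σ = 3 * (1 / σ) := by ring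
    have f4 : 2 / σ = 2 * (1 / σ) := by ring
    rw [f3] at htr
    linarith
  have key := abstract_min K ((isCompact_closedBall _ _).prod (isCompact_closedBall _ _))
    g t1 (t1 + σ) c1 c2 c3 c4
  intro x hx y hy
  have := key (t1 + σ) ⟨by linarith, le_rfl⟩ (x, y) ⟨hx, hy⟩
  simp only [hg, hv, sub_self, mul_zero, zero_div] at this
  linarith

lemma baire_portion {X : Type*} [MetricSpace X] [CompleteSpace X] (K : Set X) (hK : K.Nonempty)
    (C : ℕ → Set X) (hC : ∀ k, IsClosed (C k)) (hcov : closure K ⊆ ⋃ k, C k) :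
    ∃ k, ∃ x ∈ K, ∃ r > 0, ball x r ∩ closure K ⊆ C k := by
  have : CompleteSpace (closure K) := isClosed_closure.completeSpace_coe
  have : Nonempty (closure K) := hK.closure.to_subtype
  obtain ⟨k, x, hx⟩ := nonempty_interior_of_iUnion_of_closed
    (f := fun k => ((↑) : closure K → X) ⁻¹' C k)
    (fun k => (hC k).preimage continuous_subtype_val)
    (by
      rw [← preimage_iUnion]
      exact eq_univ_of_forall fun x => hcov x.2)
  rw [mem_interior_iff_mem_nhds, Metric.mem_nhds_iff] at hx
  obtain ⟨r, hr, hsub⟩ := hx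
  obtain ⟨y, hyK, hy⟩ := Metric.mem_closure_iff.1 x.2 r hr
  refine ⟨k, y, hyK, r - dist (x : X) y, by linarith, ?_⟩
  rintro w ⟨hw, hwK⟩
  have : (⟨w, hwK⟩ : closure K) ∈ ball x r := by
    rw [mem_ball, Subtype.dist_eq]
    have := dist_triangle_right w (x : X) y
    rw [mem_ball] at hw
    change dist w (x : X) < r
    linarith
  exact hsub this

lemma exists_theta (C ε : ℝ) (hε : 0 < ε) :
    ∃ θ > 0, θ ≤ 1 / 2 ∧ C * (2 * θ ^ 2) ^ (1 / 4 : ℝ) + 4 * θ ^ 2 ≤ ε := by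
  have hc : Continuous (fun θ : ℝ => C * (2 * θ ^ 2) ^ (1 / 4 : ℝ) + 4 * θ ^ 2) := by
    have e1 : Continuous (fun θ : ℝ => (2 * θ ^ 2) ^ (1 / 4 : ℝ)) :=
      Continuous.rpow_const (by fun_prop) (fun _ => Or.inr (by norm_num))
    exact (continuous_const.mul e1).add (by fun_prop)
  have h1 : ∀ᶠ θ in 𝓝 (0:ℝ), C * (2 * θ ^ 2) ^ (1 / 4 : ℝ) + 4 * θ ^ 2 < ε :=
    hc.continuousAt.eventually (gt_mem_nhds (by simpa using hε))
  have h2 : ∀ᶠ θ in 𝓝[>] (0:ℝ), θ ∈ Ioc (0:ℝ) (1 / 2) := Ioc_mem_nhdsGT (by norm_num)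
  obtain ⟨θ, h3, h4⟩ := ((h1.filter_mono nhdsWithin_le_nhds).and h2).exists
  exact ⟨θ, h4.1, h4.2, h3.le⟩

lemma holder' {n : ℕ} (hn : 1 ≤ n) {ν : ℝ} {a : E n × ℝ → Fin n → Fin n → ℝ} {u : E n → ℝ → ℝ}
    (hν : 0 < ν) (h : LSol ν a u) (ε : ℝ) (hε : 0 < ε) :
    ∃ θ > 0, θ ≤ 1 / 2 ∧ ∀ (x y : E n) (α s : ℝ), 0 < α → α < s →
    (∀ t ∈ Ioo α s, ∀ x' ∈ closedBall x √(s - α), RL u x' t ∧ RL (fun x t => - u x t) x' t) →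
    (∀ t ∈ Ioc α s, ∀ x' ∈ closedBall x √(s - α), ∀ y ∈ closedBall x √(s - α), ∀ i j,
      |a (y, t) i j - a (x', t) i j| ≤ ν / (6 * n ^ 2)) →
    dist y x ≤ θ * √(s - α) → u x s - u y s ≤ ε := by
  obtain ⟨θ, hθ, hθ2, hθ3⟩ := exists_theta (Hc n ν) ε hε
  refine ⟨θ, hθ, hθ2, ?_⟩
  intro x y α s hα hαs hR hosc hy
  set σ := (s - α) / 2 with hσ
  have hσ0 : 0 < σ := by rw [hσ]; linarith
  have hs : (s - σ) + σ = s := by ring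
  have hle : √σ ≤ √(s - α) := Real.sqrt_le_sqrt (by linarith)
  have hsub : closedBall x √σ ⊆ closedBall x √(s - α) := closedBall_subset_closedBall hle
  have hn2 : ‖x - y‖ ^ 2 ≤ 2 * θ ^ 2 * σ := by
    rw [dist_comm, dist_eq_norm] at hy
    have := pow_le_pow_left₀ (norm_nonneg _) hy 2
    rw [mul_pow, Real.sq_sqrt (by linarith)] at this
    have e : s - α = 2 * σ := by rw [hσ]; ring
    rw [e] at this
    linarith
  have hyb : y ∈ closedBall x √σ := by
    rw [mem_closedBall, dist_comm, dist_eq_norm]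
    apply Real.le_sqrt_of_sq_le
    have : 2 * θ ^ 2 ≤ 1 := by nlinarith
    nlinarith
  have key := holder hn hν h x σ (s - σ) hσ0 (by linarith)
    (by
      intro t ht x' hx'
      rw [hs] at ht
      exact hR t ⟨by linarith [ht.1], ht.2⟩ x' (hsub hx'))
    (by
      intro t ht x' hx' y' hy'
      rw [hs] at ht
      exact hosc t ⟨by linarith [ht.1], ht.2⟩ x' (hsub hx') y' (hsub hy'))
    x (mem_closedBall_self (Real.sqrt_nonneg _)) y hyb
  rw [hs] at key
  refine key.trans (le_trans ?_ hθ3)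
  have hH := (Hc_pos n ν hν).le
  have e1 : σ ^ (-(1 / 4) : ℝ) * (‖x - y‖ ^ 2) ^ (1 / 4 : ℝ) ≤ (2 * θ ^ 2) ^ (1 / 4 : ℝ) := by
    calc σ ^ (-(1 / 4) : ℝ) * (‖x - y‖ ^ 2) ^ (1 / 4 : ℝ)
        ≤ σ ^ (-(1 / 4) : ℝ) * (2 * θ ^ 2 * σ) ^ (1 / 4 : ℝ) := by gcongr
      _ = (2 * θ ^ 2) ^ (1 / 4 : ℝ) := by
        rw [Real.mul_rpow (by positivity) hσ0.le, Real.rpow_neg hσ0.le]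
        have : σ ^ (1 / 4 : ℝ) ≠ 0 := (Real.rpow_pos_of_pos hσ0 _).ne'
        field_simp
  have e2 : 2 / σ * (‖x - x‖ ^ 2 + ‖y - x‖ ^ 2) ≤ 4 * θ ^ 2 := by
    rw [norm_sub_rev y x]
    simp only [sub_self, norm_zero]
    calc 2 / σ * (0 ^ 2 + ‖x - y‖ ^ 2) ≤ 2 / σ * (0 ^ 2 + 2 * θ ^ 2 * σ) := by gcongr
      _ = 4 * θ ^ 2 := by field_simp; ring
  have e3 := mul_le_mul_of_nonneg_left e1 hH
  rw [← mul_assoc] at e3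
  linarith

lemma corner {n : ℕ} (hn : 1 ≤ n) {ν : ℝ} {a : E n × ℝ → Fin n → Fin n → ℝ} {u : E n → ℝ → ℝ}
    (hν : 0 < ν) (h : LSol ν a u) (z : E n) (R α β : ℝ) (hα : 0 < α) (hαβ : α < β)
    (hR : ∀ t ∈ Ioo α β, ∀ x ∈ ball z R, RL u x t ∧ RL (fun x t => - u x t) x t) :
    ∀ x ∈ ball z R, RL u x α := by
  by_contra hcon
  push Not at hcon
  set K : Set (E n) := {x ∈ ball z R | ¬ RL u x α} with hK
  have hKne : K.Nonempty := by
    obtain ⟨x, hx, hx2⟩ := hcon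
    exact ⟨x, hx, hx2⟩
  obtain ⟨k, xh, hxh, r0, hr0, hport⟩ := baire_portion K hKne
    (fun k : ℕ => {x | ∀ s ∈ Ioo α (α + 1 / (k + 1)), |u x s - u x α| ≤ (k + 1) * (s - α)})
    (by
      intro k
      simp only [ofPred_forall]
      refine isClosed_iInter fun s => isClosed_iInter fun hs => ?_
      exact isClosed_le (((h.cont (hα.trans hs.1)).sub (h.cont hα)).abs) continuous_const)
    (by
      intro x _
      obtain ⟨C, hC⟩ := (h.dt x α hα).differentiableAt.isBigO_sub.bound
      obtain ⟨δ, hδ, hδ2⟩ := Metric.eventually_nhds_iff.1 hC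
      obtain ⟨k, hk⟩ := exists_nat_ge (max C (1 / δ))
      have hk1 : C ≤ k := (le_max_left _ _).trans hk
      have hk2 : 1 / δ ≤ k := (le_max_right _ _).trans hk
      refine mem_iUnion.2 ⟨k, ?_⟩
      intro s hs
      have e1 : 1 / ((k:ℝ) + 1) ≤ δ := by
        rw [div_le_iff₀ (by positivity)]
        rw [div_le_iff₀ hδ] at hk2
        nlinarith
      have e2 : 0 < s - α := by linarith [hs.1]
      have := hδ2 (y := s) (by
        rw [Real.dist_eq, abs_of_pos e2]; linarith [hs.2])
      rw [Real.norm_eq_abs, Real.norm_eq_abs, abs_of_pos e2] at this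
      refine this.trans ?_
      gcongr
      linarith)
  set c := u xh α with hc
  obtain ⟨hxhB, hnR⟩ := hxh
  unfold RL at hnR
  push Not at hnR
  obtain ⟨ε, hε, hfr⟩ := hnR
  set L := 𝓝 xh ×ˢ 𝓝[>] α with hL
  have hpos : ∀ᶠ p in L, α < p.2 := tendsto_snd.eventually (self_mem_nhdsWithin)
  set S : Set ℝ := {M | ∀ᶠ p in L, M ≤ u p.1 p.2} with hS
  have hSne : S.Nonempty := ⟨-1, by
    filter_upwards [hpos] with p hp
    exact (abs_le.1 (h.ub p.1 p.2 (hα.trans hp))).1⟩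
  have hSub : ∀ M ∈ S, M ≤ c - ε := by
    intro M hM
    obtain ⟨p, hp1, hp2⟩ := (hfr.and_eventually hM).exists
    exact hp2.trans hp1
  have hSb : BddAbove S := ⟨c - ε, hSub⟩
  set Ms := sSup S with hMs
  have hMle : Ms ≤ c - ε := csSup_le hSne hSub
  obtain ⟨θ, hθ, hθ2, hhol⟩ := holder' hn hν h (ε / 8) (by linarith)
  set e := Real.exp (-(4 * Kc n ν / θ ^ 2)) with he
  have he0 : 0 < e := Real.exp_pos _
  have he1 : e ≤ 1 := Real.exp_le_one_iff.2 (by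
    have := Kc_nonneg n ν hν
    have : 0 ≤ 4 * Kc n ν / θ ^ 2 := by positivity
    linarith)
  set γ := ε / 4 * e with hγ
  have hγ0 : 0 < γ := by positivity
  have hγ1 : γ ≤ ε / 4 := by nlinarith
  have hlow : ∀ᶠ p in L, Ms - γ ≤ u p.1 p.2 := by
    obtain ⟨M', hM', hlt⟩ := exists_lt_of_lt_csSup hSne (show Ms - γ < sSup S by linarith)
    have hM'' : ∀ᶠ p in L, M' ≤ u p.1 p.2 := hM'
    exact hM''.mono fun p hp => hlt.le.trans hp
  have hup : ∃ᶠ p in L, u p.1 p.2 < Ms + γ := by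
    intro hne
    have : Ms + γ ∈ S := hne.mono fun p hp => not_lt.1 hp
    have := le_csSup hSb this
    linarith
  -- radii
  obtain ⟨ra, hra, hra2⟩ := Metric.isOpen_iff.1 isOpen_ball xh hxhB
  obtain ⟨rb, hrb, hrb2⟩ := Metric.continuousAt_iff.1 ((h.cont hα).continuousAt (x := xh)) (ε / 8)
    (by linarith)
  have hn0 : (0:ℝ) < n := by exact_mod_cast hn
  obtain ⟨rc, hrc, hrc2⟩ : ∃ rc > 0, ∀ x t, dist x xh < rc → |t - α| < rc → ∀ i j,
      |a (x, t) i j - a (xh, α) i j| < ν / (12 * n ^ 2) := by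
    have : ∀ᶠ X in 𝓝 (xh, α), ∀ i j, |a X i j - a (xh, α) i j| < ν / (12 * n ^ 2) := by
      rw [eventually_all]; intro i
      rw [eventually_all]; intro j
      have := (Metric.continuousAt_iff'.1 (h.ac xh α hα i j)) (ν / (12 * n ^ 2)) (by positivity)
      simpa only [Real.dist_eq] using this
    obtain ⟨rc, hrc, hrc2⟩ := Metric.eventually_nhds_iff.1 this
    refine ⟨rc, hrc, fun x t hx ht => hrc2 (y := (x, t)) ?_⟩
    rw [Prod.dist_eq, max_lt_iff]
    exact ⟨hx, by rw [Real.dist_eq]; exact ht⟩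
  obtain ⟨rd, hrd, hrd2⟩ : ∃ rd > 0, ∀ x t, dist x xh < rd → α < t → t < α + rd →
      Ms - γ ≤ u x t := by
    obtain ⟨p1, h1, p2, h2, h3⟩ := eventually_prod_iff.1 hlow
    obtain ⟨δ1, hδ1, h1'⟩ := Metric.eventually_nhds_iff.1 h1
    obtain ⟨t', ht', h2'⟩ := mem_nhdsGT_iff_exists_Ioo_subset.1 h2
    refine ⟨min δ1 (t' - α), lt_min hδ1 (sub_pos.2 ht'), ?_⟩
    intro x t hx ht1 ht2
    refine h3 (h1' (lt_of_lt_of_le hx (min_le_left _ _))) (h2' ⟨ht1, ?_⟩)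
    have := min_le_right δ1 (t' - α)
    linarith
  set rk : ℝ := min (1 / ((k:ℝ) + 1)) (ε / 8 / (k + 1)) with hrk
  have hrk0 : 0 < rk := lt_min (by positivity) (by positivity)
  obtain ⟨r, hr, hr0', hra', hrb', hrc', hrd', hrk', hrβ⟩ : ∃ r > 0, r ≤ r0 ∧ r ≤ ra ∧ r ≤ rb ∧
      r ≤ rc ∧ r ≤ rd ∧ r ≤ rk ∧ r ≤ β - α := by
    refine ⟨min r0 (min ra (min rb (min rc (min rd (min rk (β - α)))))), ?_, ?_⟩
    · have : 0 < β - α := by linarith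
      positivity
    · refine ⟨?_, ?_, ?_, ?_, ?_, ?_, ?_⟩ <;> simp
  have hev : ∀ᶠ p in L, dist p.1 xh < r / 3 ∧ p.2 ∈ Ioo α (α + min r ((r / 3) ^ 2)) := by
    refine (tendsto_fst.eventually (ball_mem_nhds xh (show 0 < r / 3 by linarith))).and
      (tendsto_snd.eventually (Ioo_mem_nhdsGT ?_))
    have : 0 < min r ((r / 3) ^ 2) := by positivity
    linarith
  obtain ⟨⟨y, s⟩, hys, hy, hs⟩ := (hup.and_eventually hev).exists
  simp only at hys hy hs
  have hαs := hs.1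
  have hsr : s - α < r := by have := min_le_left r ((r / 3) ^ 2); linarith [hs.2]
  have hsr2 : s - α < (r / 3) ^ 2 := by have := min_le_right r ((r / 3) ^ 2); linarith [hs.2]
  set w := √(s - α) with hw
  have hw0 : 0 < w := Real.sqrt_pos.2 (by linarith)
  have hwsq : w ^ 2 = s - α := Real.sq_sqrt (by linarith)
  have hwr : w < r / 3 := by
    rw [hw, Real.sqrt_lt' (by linarith)]; exact hsr2
  have hBsub : ∀ x, dist x xh < r → x ∈ ball z R := fun x hx => hra2 (hx.trans_le hra')
  have hua : ∀ x, dist x xh < r → |u x α - c| < ε / 8 := by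
    intro x hx
    have := hrb2 (hx.trans_le hrb')
    rwa [Real.dist_eq] at this
  by_cases hcase : ∃ x ∈ K, dist y x < θ * w
  · obtain ⟨x, hxK, hyx⟩ := hcase
    have hθw : θ * w ≤ w / 2 := by nlinarith
    have hxd : dist x xh < r / 3 + r / 6 := by
      have := dist_triangle_left x xh y
      linarith
    have hxr : dist x xh < r := by linarith
    have hball : ∀ x' ∈ closedBall x w, dist x' xh < r := by
      intro x' hx'
      rw [mem_closedBall] at hx'
      have := dist_triangle x' x xh
      linarith
    have key := hhol x y α s hα hαs
      (fun t ht x' hx' => hR t ⟨ht.1, by linarith [ht.2]⟩ x' (hBsub _ (hball x' hx')))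
      (by
        intro t ht x' hx' y' hy' i j
        have ht' : |t - α| < rc := by
          rw [abs_of_pos (by linarith [ht.1])]; linarith [ht.2]
        have e1 := hrc2 x' t ((hball x' hx').trans_le hrc') ht' i j
        have e2 := hrc2 y' t ((hball y' hy').trans_le hrc') ht' i j
        have e3 : ν / (6 * (n:ℝ) ^ 2) = ν / (12 * n ^ 2) + ν / (12 * n ^ 2) := by
          field_simp; ring
        rw [abs_lt] at e1 e2
        rw [e3, abs_le]
        constructor <;> linarith [e1.1, e1.2, e2.1, e2.2])
      hyx.le
    have hxC := hport ⟨mem_ball.2 (hxr.trans_le hr0'), subset_closure hxK⟩ s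
      ⟨hαs, by have := min_le_left (1 / ((k:ℝ) + 1)) (ε / 8 / (k + 1)); linarith⟩
    have e1 : ((k:ℝ) + 1) * (s - α) ≤ ε / 8 := by
      have : s - α ≤ ε / 8 / (k + 1) := by
        have := min_le_right (1 / ((k:ℝ) + 1)) (ε / 8 / (k + 1)); linarith
      rw [le_div_iff₀ (by positivity)] at this
      linarith
    have e2 := abs_le.1 (hxC.trans e1)
    have e3 := abs_lt.1 (hua x hxr)
    linarith [e2.1, e3.1]
  · push Not at hcase
    have hρ : 0 < θ * w / 2 := by positivity
    have hθw : θ * w ≤ w / 2 := by nlinarith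
    have hball : ∀ x' ∈ closedBall y (θ * w / 2), dist x' xh < r := by
      intro x' hx'
      rw [mem_closedBall] at hx'
      have := dist_triangle x' y xh
      linarith
    have key := barrier hν h y (θ * w / 2) α s (Ms - γ) (c - ε / 8 - (Ms - γ)) hρ hα.le hαs.le
      (by linarith)
      (by
        intro t ht x' hx'
        rcases ht.1.eq_or_lt with rfl | hlt
        · by_contra hno
          have := hcase x' ⟨hBsub _ (hball x' hx'), hno⟩
          rw [mem_closedBall, dist_comm] at hx'
          have : 0 < θ * w := by positivity
          linarith
        · exact (hR t ⟨hlt, by linarith [ht.2]⟩ x' (hBsub _ (hball x' hx'))).1)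
      (by
        intro t ht x' hx'
        exact hrd2 x' t ((hball x' hx').trans_le hrd') ht.1 (by linarith [ht.2]))
      (by
        intro x' hx'
        have := abs_lt.1 (hua x' (hball x' hx'))
        linarith [this.1])
    have e1 : Kc n ν * (s - α) / (θ * w / 2) ^ 2 = 4 * Kc n ν / θ ^ 2 := by
      rw [← hwsq]; field_simp; ring
    rw [e1, ← he] at key
    have e2 : 7 / 8 * ε * e ≤ (c - ε / 8 - (Ms - γ)) * e := by
      gcongr
      linarith
    have e3 : 2 * γ < 7 / 8 * ε * e := by
      have : 0 < ε * e := by positivity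
      rw [hγ]; linarith
    linarith

lemma time_step {n : ℕ} (hn : 1 ≤ n) {ν : ℝ} {a : E n × ℝ → Fin n → Fin n → ℝ}
    {u : E n → ℝ → ℝ} (hν : 0 < ν) (h : LSol ν a u) (z : E n) (R th r : ℝ) (m : ℕ)
    (hth : 0 < th) (hr : 0 < r) (F : Set ℝ) (hF : IsClosed F) (hthF : th ∈ F)
    (hgood : ∀ t, 0 < t → t ∉ F → ∀ x ∈ ball z R, RL u x t ∧ RL (fun x t => - u x t) x t)
    (hlip : ∀ t ∈ F, th ≤ t → t < th + r → ∀ x ∈ ball z R, ∀ y ∈ ball z R,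
      |u x t - u y t| ≤ m * dist x y) :
    ∀ x ∈ ball z R, RL u x th := by
  intro x hx ε hε
  obtain ⟨d, hd, hd2⟩ := Metric.isOpen_iff.1 isOpen_ball x hx
  obtain ⟨ρ, hρ, hρd, hρ1, hρε⟩ : ∃ ρ > 0, ρ ≤ d / 3 ∧ m * ρ ≤ 1 ∧ m * ρ ≤ ε / 8 := by
    refine ⟨min (d / 3) (min (1 / (m + 1)) (ε / 8 / (m + 1))), by positivity, min_le_left _ _, ?_, ?_⟩
    · have e1 : min (d / 3) (min (1 / ((m:ℝ) + 1)) (ε / 8 / (m + 1))) ≤ 1 / (m + 1) := by simp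
      calc _ ≤ (m:ℝ) * (1 / (m + 1)) := mul_le_mul_of_nonneg_left e1 (by positivity)
        _ ≤ 1 := by rw [mul_one_div, div_le_one (by positivity)]; linarith
    · have e1 : min (d / 3) (min (1 / ((m:ℝ) + 1)) (ε / 8 / (m + 1))) ≤ ε / 8 / (m + 1) := by simp
      calc _ ≤ (m:ℝ) * (ε / 8 / (m + 1)) := mul_le_mul_of_nonneg_left e1 (by positivity)
        _ ≤ ε / 8 := by
          rw [← mul_div_assoc, div_le_iff₀ (by positivity)]; nlinarith
  obtain ⟨δ1, hδ1, hδ1'⟩ := Metric.continuousAt_iff.1 (h.dt x th hth).continuousAt (ε / 8)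
    (by linarith)
  have hec : Continuous (fun τ : ℝ => 3 * (1 - Real.exp (-(Kc n ν * τ / ρ ^ 2)))) := by fun_prop
  obtain ⟨δ2, hδ2, hδ2'⟩ := Metric.continuousAt_iff.1 (hec.continuousAt (x := 0)) (ε / 8)
    (by linarith)
  set δ := min r (min δ1 δ2) with hδ
  have hδ0 : 0 < δ := by positivity
  have hδr : δ ≤ r := min_le_left _ _
  have hδ11 : δ ≤ δ1 := by simp [hδ]
  have hδ22 : δ ≤ δ2 := by simp [hδ]
  have hev : ∀ᶠ p in 𝓝 x ×ˢ 𝓝[>] th, dist p.1 x < ρ ∧ p.2 ∈ Ioo th (th + δ) :=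
    (tendsto_fst.eventually (ball_mem_nhds x hρ)).and
      (tendsto_snd.eventually (Ioo_mem_nhdsGT (by linarith)))
  filter_upwards [hev] with p hp
  obtain ⟨y, s⟩ := p
  obtain ⟨hy, hs⟩ := hp
  simp only at hy hs ⊢
  obtain ⟨α, hαm, hαg⟩ := ((isCompact_Icc (a := th) (b := s)).inter_left hF).exists_isGreatest
    ⟨th, hthF, le_rfl, hs.1.le⟩
  obtain ⟨hαF, hα1, hα2⟩ := hαm
  have hα0 : 0 < α := by linarith
  have hgood' : ∀ t ∈ Ioc α s, ∀ x ∈ ball z R, RL u x t ∧ RL (fun x t => - u x t) x t := by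
    intro t ht
    refine hgood t (by linarith [ht.1]) fun hmem => ?_
    have := hαg ⟨hmem, by linarith [ht.1], ht.2⟩
    linarith [ht.1]
  have hyb : ∀ x' ∈ closedBall y ρ, x' ∈ ball z R := by
    intro x' hx'
    rw [mem_closedBall] at hx'
    apply hd2
    rw [mem_ball]
    have := dist_triangle x' y x
    linarith
  have hyy : y ∈ ball z R := hyb y (mem_closedBall_self hρ.le)
  have hL := hlip α hαF hα1 (by linarith [hs.2])
  have hcorner : ∀ t ∈ Ico α s, ∀ x ∈ ball z R, RL u x t := by
    intro t ht x' hx'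
    rcases ht.1.eq_or_lt with rfl | hlt
    · exact corner hn hν h z R α s hα0 ht.2
        (fun t ht => hgood' t ⟨ht.1, ht.2.le⟩) x' hx'
    · exact (hgood' t ⟨hlt, ht.2.le⟩ x' hx').1
  have hya := abs_le.1 (h.ub y α hα0)
  have key := barrier hν h y ρ α s (-2) (u y α - m * ρ + 2) hρ hα0.le hα2 (by linarith [hya.1])
    (fun t ht x' hx' => hcorner t ht x' (hyb x' hx'))
    (fun t ht x' hx' => by
      have := (abs_le.1 (h.ub x' t (by linarith [ht.1]))).1
      linarith)
    (fun x' hx' => by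
      have e1 := (abs_le.1 (hL x' (hyb x' hx') y hyy)).1
      have e2 : (m:ℝ) * dist x' y ≤ m * ρ :=
        mul_le_mul_of_nonneg_left hx' (by positivity)
      linarith)
  set e := Real.exp (-(Kc n ν * (s - α) / ρ ^ 2)) with he
  have he3 : 3 * (1 - e) < ε / 8 := by
    have := hδ2' (x := s - α) (by
      rw [dist_zero_right, Real.norm_eq_abs, abs_of_nonneg (by linarith)]
      linarith [hs.2])
    rw [Real.dist_eq] at this
    simp only [mul_zero, zero_div, neg_zero, Real.exp_zero, sub_self, sub_zero] at this
    exact (le_abs_self _).trans_lt this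
  have he1 : e ≤ 1 := Real.exp_le_one_iff.2 (by
    have := Kc_nonneg n ν hν
    have h2 : 0 ≤ s - α := by linarith
    have : 0 ≤ Kc n ν * (s - α) / ρ ^ 2 := by positivity
    linarith)
  have e1 : (u y α - m * ρ + 2) * (1 - e) ≤ 3 * (1 - e) := by
    have : 0 ≤ (m:ℝ) * ρ := by positivity
    exact mul_le_mul_of_nonneg_right (by linarith [hya.2]) (by linarith)
  have e2 : |u x α - u x th| < ε / 8 := by
    have := hδ1' (x := α) (by
      rw [Real.dist_eq, abs_of_nonneg (by linarith)]
      linarith [hs.2])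
    rwa [Real.dist_eq] at this
  have e3 := (abs_le.1 (hL y hyy x hx)).1
  have e4 : (m:ℝ) * dist y x ≤ m * ρ := mul_le_mul_of_nonneg_left hy.le (by positivity)
  have e5 := (abs_lt.1 e2).1
  linarith

lemma all_RL {n : ℕ} (hn : 1 ≤ n) {ν : ℝ} {a : E n × ℝ → Fin n → Fin n → ℝ}
    {u : E n → ℝ → ℝ} (hν : 0 < ν) (h : LSol ν a u) (z : E n) (t : ℝ) (ht : 0 < t) :
    RL u z t := by
  set B := ball z 1 with hB
  set F0 : Set ℝ := {t | 0 < t ∧ ¬ ∀ x ∈ B, RL u x t ∧ RL (fun x t => - u x t) x t} with hF0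
  by_contra hcon
  have hne : F0.Nonempty := ⟨t, ht, fun hall => hcon (hall z (mem_ball_self one_pos)).1⟩
  have hzz : z ∈ closedBall z 1 := mem_closedBall_self zero_le_one
  obtain ⟨m, th, hth, r, hr, hport⟩ := baire_portion F0 hne
    (fun m : ℕ => Iic 0 ∪ ⋂ x ∈ closedBall z 1, ⋂ y ∈ closedBall z 1,
      (Ici (1 / ((m:ℝ) + 1)) ∩ (fun t => |u x t - u y t|) ⁻¹' Iic (m * dist x y)))
    (by
      intro m
      refine isClosed_Iic.union (isClosed_biInter fun x _ => isClosed_biInter fun y _ => ?_)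
      refine ContinuousOn.preimage_isClosed_of_isClosed ?_ isClosed_Ici isClosed_Iic
      intro t ht
      have ht0 : 0 < t := lt_of_lt_of_le (by positivity) (mem_Ici.1 ht)
      exact (((h.dt x t ht0).continuousAt.sub
        (h.dt y t ht0).continuousAt).abs).continuousWithinAt)
    (by
      intro t _
      rcases le_or_gt t 0 with ht0 | ht0
      · exact mem_iUnion.2 ⟨0, Or.inl ht0⟩
      · have hc1 : ContDiff ℝ 1 (fun x => u x t) :=
          contDiff_iff_contDiffAt.2 fun x => (h.c2 x t ht0).of_le (by norm_num)
        obtain ⟨C, hC⟩ := LocallyLipschitzOn.exists_lipschitzOnWith_of_compact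
          (isCompact_closedBall z 1) (hc1.locallyLipschitz.locallyLipschitzOn)
        obtain ⟨m, hm⟩ := exists_nat_ge (max (C:ℝ) (1 / t))
        have hm1 : (C:ℝ) ≤ m := (le_max_left _ _).trans hm
        have hm2 : 1 / t ≤ m := (le_max_right _ _).trans hm
        refine mem_iUnion.2 ⟨m, Or.inr ?_⟩
        simp only [mem_iInter]
        intro x hx y hy
        refine ⟨?_, ?_⟩
        · rw [mem_Ici, div_le_iff₀ (by positivity)]
          rw [div_le_iff₀ ht0] at hm2
          nlinarith
        · have := hC.dist_le_mul x hx y hy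
          rw [Real.dist_eq] at this
          exact this.trans (mul_le_mul_of_nonneg_right hm1 dist_nonneg))
  obtain ⟨hth0, hbad⟩ := hth
  apply hbad
  have hgood : ∀ t, 0 < t → t ∉ closure F0 → ∀ x ∈ ball z 1,
      RL u x t ∧ RL (fun x t => - u x t) x t := by
    intro t ht0 htn
    by_contra hno
    exact htn (subset_closure ⟨ht0, hno⟩)
  have hlip : ∀ t ∈ closure F0, th ≤ t → t < th + r → ∀ x ∈ ball z 1, ∀ y ∈ ball z 1,
      |u x t - u y t| ≤ m * dist x y := by
    intro t htF ht1 ht2 x hx y hy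
    have hb : t ∈ ball th r := by
      rw [mem_ball, Real.dist_eq, abs_of_nonneg (by linarith)]; linarith
    rcases hport ⟨hb, htF⟩ with h1 | h1
    · have : t ≤ 0 := h1
      linarith
    · simp only [mem_iInter] at h1
      exact (h1 x (ball_subset_closedBall hx) y (ball_subset_closedBall hy)).2
  have hthF : th ∈ closure F0 := subset_closure ⟨hth0, hbad⟩
  intro x hx
  refine ⟨time_step hn hν h z 1 th r m hth0 hr _ isClosed_closure hthF hgood hlip x hx,
    time_step hn hν h.neg z 1 th r m hth0 hr _ isClosed_closure hthF ?_ ?_ x hx⟩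
  · intro t ht0 htn x hx
    have := hgood t ht0 htn x hx
    simp only [neg_neg]
    exact ⟨this.2, this.1⟩
  · intro t htF ht1 ht2 x hx y hy
    have := hlip t htF ht1 ht2 x hx y hy
    rw [← abs_neg]
    convert this using 2
    ring

/-- The solution with boundary data `φ`, extended by `φ` at nonpositive times. -/
def extSol {n : ℕ} (ω : E n × ℝ → Measure (E n × ℝ)) (φ : E n × ℝ → ℝ) (x : E n) (t : ℝ) : ℝ :=
  if t ≤ 0 then φ (x, 0) else ∫ z, φ z ∂ω (x, t)

lemma extSol_pos {n : ℕ} (ω : E n × ℝ → Measure (E n × ℝ)) (φ : E n × ℝ → ℝ) (x : E n) {t : ℝ}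
    (ht : 0 < t) : extSol ω φ x t = ∫ z, φ z ∂ω (x, t) := by
  simp [extSol, not_le.2 ht]

lemma extSol_LSol {n : ℕ} {ν : ℝ} {a : E n × ℝ → Fin n → Fin n → ℝ}
    (ha : IsParabolicCoeff ν a (closure (Cyl (univ : Set (E n)))))
    (ω : E n × ℝ → Measure (E n × ℝ)) (hω : IsCaloricMeasure a univ ω)
    (φ : E n × ℝ → ℝ) (hφ : Continuous φ) (hφ1 : ∀ z, |φ z| ≤ 1) : LSol ν a (extSol ω φ) := by
  have hmem : ∀ (x : E n) (t : ℝ), 0 < t → (x, t) ∈ Cyl (univ : Set (E n)) :=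
    fun x t ht => ⟨mem_univ _, ht⟩
  have hopen : IsOpen (Cyl (univ : Set (E n))) := isOpen_univ.prod isOpen_Ioi
  obtain ⟨⟨hsm, hL⟩, -⟩ := hω.2 φ hφ ⟨1, hφ1⟩
  have hslice : ∀ t : ℝ, 0 < t → (fun x => extSol ω φ x t) = fun x => ∫ z, φ z ∂ω (x, t) :=
    fun t ht => funext fun x => extSol_pos ω φ x ht
  refine ⟨?_, ?_, ?_, ?_, ?_, ?_⟩
  · exact fun x t ht => (ha.2 _ (subset_closure (hmem x t ht))).1
  · exact fun x t ht => (ha.2 _ (subset_closure (hmem x t ht))).2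
  · intro x t ht i j
    exact ((ha.1 i j).contDiffAt (mem_of_superset (hopen.mem_nhds (hmem x t ht))
      subset_closure)).continuousAt
  · intro x t ht
    rw [hslice t ht]
    exact (hsm _ (hmem x t ht)).1
  · intro x t ht
    rw [hslice t ht]
    have h1 := (hsm _ (hmem x t ht)).2.hasDerivAt
    have h2 := hL _ (hmem x t ht)
    have h3 : ∑ i, ∑ j, a (x, t) i j * Hs (fun x => ∫ z, φ z ∂ω (x, t)) x i j =
        deriv (fun t => ∫ z, φ z ∂ω (x, t)) t := by
      have h4 : (∑ i, ∑ j, a (x, t) i j * Hs (fun x => ∫ z, φ z ∂ω (x, t)) x i j) -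
        deriv (fun t => ∫ z, φ z ∂ω (x, t)) t = 0 := h2
      linarith
    rw [h3]
    refine HasDerivAt.congr_of_eventuallyEq h1 ?_
    filter_upwards [lt_mem_nhds ht] with t' ht'
    exact extSol_pos ω φ x ht'
  · intro x t ht
    rw [extSol_pos ω φ x ht]
    have := (hω.1 (x, t) (hmem x t ht)).1
    have := norm_integral_le_of_norm_le_const (μ := ω (x, t)) (f := φ) (C := 1)
      (Eventually.of_forall hφ1)
    simpa using this

lemma extSol_RL0 {n : ℕ} {a : E n × ℝ → Fin n → Fin n → ℝ}
    (ω : E n × ℝ → Measure (E n × ℝ)) (hω : IsCaloricMeasure a univ ω)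
    (φ : E n × ℝ → ℝ) (hφ : Continuous φ) (hφ1 : ∀ z, |φ z| ≤ 1) (x : E n) :
    RL (extSol ω φ) x 0 := by
  intro ε hε
  have h1 := (hω.2 φ hφ ⟨1, hφ1⟩).2 (x, 0) (Or.inr ⟨by simp, rfl⟩)
  have h2 : nhdsWithin (x, (0:ℝ)) (CylFrom (univ : Set (E n)) 0) = 𝓝 x ×ˢ 𝓝[>] 0 := by
    unfold CylFrom
    rw [nhdsWithin_prod_eq, nhdsWithin_univ]
  rw [h2] at h1
  have h3 : extSol ω φ x 0 = φ (x, 0) := by simp [extSol]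
  have hpos : ∀ᶠ p in 𝓝 x ×ˢ 𝓝[>] (0:ℝ), 0 < p.2 := tendsto_snd.eventually self_mem_nhdsWithin
  filter_upwards [h1.eventually (lt_mem_nhds (show φ (x, 0) - ε < φ (x, 0) by linarith)), hpos]
    with p hp hp2
  rw [h3, extSol_pos ω φ p.1 hp2]
  exact hp

lemma cutoff {n : ℕ} (x y : E n) (r : ℝ) (hd : 0 < r - dist x y) :
    ∃ φ : E n × ℝ → ℝ, Continuous φ ∧ (∀ z, 0 ≤ φ z) ∧ (∀ z, φ z ≤ 1) ∧
      (∀ z : E n × ℝ, dist z.1 x ≤ r → φ z = 1) ∧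
      (∀ z : E n × ℝ, z.1 ∉ ball y (2 * r) → φ z = 0) := by
  refine ⟨fun z => max 0 (min 1 ((2 * r - dist z.1 y) / (r - dist x y))), ?_,
    fun z => le_max_left _ _, fun z => max_le zero_le_one (min_le_left _ _), ?_, ?_⟩
  · have h1 : Continuous (fun z : E n × ℝ => dist z.1 y) := continuous_fst.dist continuous_const
    exact continuous_const.max (continuous_const.min ((continuous_const.sub h1).div_const _))
  · intro z hz
    have e1 := dist_triangle z.1 x y
    have e2 : 1 ≤ (2 * r - dist z.1 y) / (r - dist x y) := by
      rw [le_div_iff₀ hd]; linarith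
    simp [min_eq_left e2]
  · intro z hz
    rw [mem_ball, not_lt] at hz
    have e2 : (2 * r - dist z.1 y) / (r - dist x y) ≤ 0 :=
      div_nonpos_of_nonpos_of_nonneg (by linarith) hd.le
    exact max_eq_left ((min_le_right _ _).trans e2)

/-- **Lemma 4.1(a)**: for `Q = ℝⁿ × (0,∞)`, `Y = (y,0) ∈ ∂_pQ` and `r > 0`, the
`L`-caloric measure satisfies `ω^X(Δ_{2r}(Y)) ≥ 1/N` for all
`X ∈ Q_r(Y) = B_r(y) × (0, r²)`, where `N = N(n, ν) ≥ 1` and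
`Δ_{2r}(Y) = B_{2r}(y) × {0}`. -/
theorem caloric_measure_lower_bound_whole_space (n : ℕ) (hn : 1 ≤ n) (ν : ℝ)
    (hν : ν ∈ Ioc (0 : ℝ) 1) :
    ∃ N : ℝ, 1 ≤ N ∧
      ∀ (a : E n × ℝ → Fin n → Fin n → ℝ),
        IsParabolicCoeff ν a (closure (Cyl (univ : Set (E n)))) →
      ∀ ω : E n × ℝ → Measure (E n × ℝ), IsCaloricMeasure a univ ω →
      ∀ (y : E n) (r : ℝ), 0 < r →
      ∀ X ∈ ball y r ×ˢ Ioo (0 : ℝ) (r ^ 2),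
        ENNReal.ofReal (1 / N) ≤ ω X (ball y (2 * r) ×ˢ {(0 : ℝ)}) := by
  have hν0 := hν.1
  have hK := Kc_nonneg n ν hν0
  refine ⟨Real.exp (Kc n ν), Real.one_le_exp hK, ?_⟩
  rintro a ha ω hω y r hr ⟨x, t⟩ ⟨hx, ht⟩
  simp only at hx ht
  have ht0 : 0 < t := ht.1
  have hd : 0 < r - dist x y := by rw [mem_ball] at hx; linarith
  obtain ⟨φ, hφ, hφ0, hφle, hφone, hφzero⟩ := cutoff x y r hd
  have hφ1 : ∀ z, |φ z| ≤ 1 := fun z => by rw [abs_of_nonneg (hφ0 z)]; exact hφle z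
  have hS := extSol_LSol ha ω hω φ hφ hφ1
  have hsolnn : ∀ x t, 0 < t → 0 ≤ extSol ω φ x t := by
    intro x t ht
    rw [extSol_pos ω φ x ht]
    exact integral_nonneg hφ0
  have b1 : ∀ s ∈ Ico (0:ℝ) t, ∀ x' ∈ closedBall x r, RL (extSol ω φ) x' s := by
    intro s hs x' _
    rcases hs.1.eq_or_lt with h0 | hlt
    · rw [← h0]
      exact extSol_RL0 ω hω φ hφ hφ1 x'
    · exact all_RL hn hν0 hS x' s hlt
  have b2 : ∀ s ∈ Ioc (0:ℝ) t, ∀ x' ∈ closedBall x r, 0 ≤ extSol ω φ x' s :=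
    fun s hs x' _ => hsolnn x' s hs.1
  have b3 : ∀ x' ∈ closedBall x r, 0 + 1 ≤ extSol ω φ x' 0 := by
    intro x' hx'
    have e1 : extSol ω φ x' 0 = φ (x', 0) := by simp [extSol]
    have e2 : φ (x', 0) = 1 := hφone (x', 0) (mem_closedBall.1 hx')
    rw [e1, e2, zero_add]
  have key := barrier hν0 hS x r 0 t 0 1 hr le_rfl ht0.le zero_le_one b1 b2 b3
  rw [extSol_pos ω φ x ht0] at key
  have hlow : 1 / Real.exp (Kc n ν) ≤ ∫ z, φ z ∂ω (x, t) := by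
    refine le_trans ?_ key
    rw [one_div, ← Real.exp_neg, zero_add, one_mul]
    apply Real.exp_le_exp.2
    apply neg_le_neg
    rw [sub_zero, div_le_iff₀ (by positivity)]
    exact mul_le_mul_of_nonneg_left ht.2.le hK
  obtain ⟨hprob, hsupp⟩ := hω.1 (x, t) ⟨mem_univ _, ht0⟩
  have hpb : pBFrom (univ : Set (E n)) 0 = univ ×ˢ {(0:ℝ)} := by
    simp [pBFrom]
  rw [hpb] at hsupp
  set A : Set (E n × ℝ) := ball y (2 * r) ×ˢ univ with hA
  have hAm : MeasurableSet A := measurableSet_ball.prod MeasurableSet.univ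
  have hle : ∫ z, φ z ∂ω (x, t) ≤ (ω (x, t)).real A := by
    rw [← integral_indicator_one hAm]
    refine integral_mono ?_ ?_ ?_
    · exact Integrable.of_bound hφ.aestronglyMeasurable 1 (Eventually.of_forall hφ1)
    · exact (integrable_const (1:ℝ)).indicator hAm
    · intro z
      by_cases hz : z ∈ A
      · simp only [indicator_of_mem hz, Pi.one_apply]; exact hφle z
      · rw [indicator_of_notMem hz, hφzero z (fun h => hz ⟨h, mem_univ _⟩)]
  have hAle : ω (x, t) A ≤ ω (x, t) (ball y (2 * r) ×ˢ {(0 : ℝ)}) := by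
    have hsub : A ⊆ (ball y (2 * r) ×ˢ {(0 : ℝ)}) ∪ (univ ×ˢ {(0:ℝ)})ᶜ := by
      rintro ⟨z, s⟩ ⟨hz, -⟩
      by_cases hs : s = 0
      · exact Or.inl ⟨hz, hs⟩
      · exact Or.inr (fun hh => hs hh.2)
    refine (measure_mono hsub).trans ((measure_union_le _ _).trans ?_)
    rw [hsupp, add_zero]
  refine le_trans ?_ hAle
  rw [ENNReal.ofReal_le_iff_le_toReal (measure_ne_top _ _)]
  exact hlow.trans hle
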